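/- Let V = ℂ(X,Y)[Z]_{(Z)} = ℂ(X,Y) + ZV and R = ℂ[X,Y] + ZV. Then gldim(R) = 3, wdim(R) = 2, and cot.D(R) = 2; in particular cot.D(R) < gldim(R) < cot.D(R) + wdim(R). -/

import Mathlib

open CategoryTheory Opposite

noncomputable section

universe u

variable (R : Type u) [CommRing R]

/-- `ExtVanish R M N n` : the `n`-th Ext group `Ext^n_R(M, N)` vanishes. -/
def ExtVanish (M N : ModuleCat.{u} R) (n : ℕ) : Prop :=
  Subsingleton (((Ext R (ModuleCat.{u} R) n).obj (op M)).obj N)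

/-- `TorVanish R M N n` : the `n`-th Tor group `Tor_n^R(M, N)` vanishes. -/
def TorVanish (M N : ModuleCat.{u} R) (n : ℕ) : Prop :=
  Subsingleton (((Tor (ModuleCat.{u} R) n).obj M).obj N)

/-- `pdLE R M n` : the projective dimension of `M` is at most `n`. -/
def pdLE (M : ModuleCat.{u} R) (n : ℕ) : Prop :=
  ∀ N : ModuleCat.{u} R, ExtVanish R M N (n + 1)

/-- `idLE R M n` : the injective dimension of `M` is at most `n`. -/
def idLE (M : ModuleCat.{u} R) (n : ℕ) : Prop :=
  ∀ N : ModuleCat.{u} R, ExtVanish R N M (n + 1)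

/-- `fdLE R M n` : the flat dimension of `M` is at most `n`. -/
def fdLE (M : ModuleCat.{u} R) (n : ℕ) : Prop :=
  ∀ N : ModuleCat.{u} R, TorVanish R M N (n + 1)

/-- `cdLE R M n` : the cotorsion dimension of `M` is at most `n`, i.e.
`Ext^{n+1}_R(F, M) = 0` for every flat `R`-module `F`. -/
def cdLE (M : ModuleCat.{u} R) (n : ℕ) : Prop :=
  ∀ F : ModuleCat.{u} R, Module.Flat R F → ExtVanish R F M (n + 1)

/-- The projective dimension of a module, as an element of `ℕ∞`. -/
def pd (M : ModuleCat.{u} R) : ℕ∞ := sInf ((↑) '' {n : ℕ | pdLE R M n})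

/-- The injective dimension of a module, as an element of `ℕ∞`. -/
def injd (M : ModuleCat.{u} R) : ℕ∞ := sInf ((↑) '' {n : ℕ | idLE R M n})

/-- The flat dimension of a module, as an element of `ℕ∞`. -/
def fd (M : ModuleCat.{u} R) : ℕ∞ := sInf ((↑) '' {n : ℕ | fdLE R M n})

/-- The cotorsion dimension of a module, as an element of `ℕ∞`. -/
def cd (M : ModuleCat.{u} R) : ℕ∞ := sInf ((↑) '' {n : ℕ | cdLE R M n})

/-- The global dimension of a ring. -/
def gldim : ℕ∞ := ⨆ M : ModuleCat.{u} R, pd R M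

/-- The weak global dimension of a ring. -/
def wdim : ℕ∞ := ⨆ M : ModuleCat.{u} R, fd R M

/-- The global cotorsion dimension of a ring: the supremum of the projective
dimensions of all flat modules. -/
def cotD : ℕ∞ := ⨆ (M : ModuleCat.{u} R) (_ : Module.Flat R M), pd R M

/-- The finitistic projective dimension of a ring. -/
def FPD : ℕ∞ := sSup {d : ℕ∞ | d ≠ ⊤ ∧ ∃ M : ModuleCat.{u} R, pd R M = d}

/-- The finitistic flat dimension of a ring. -/
def FFD : ℕ∞ := sSup {d : ℕ∞ | d ≠ ⊤ ∧ ∃ M : ModuleCat.{u} R, fd R M = d}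

/-- The finitistic injective dimension of a ring. -/
def FID : ℕ∞ := sSup {d : ℕ∞ | d ≠ ⊤ ∧ ∃ M : ModuleCat.{u} R, injd R M = d}

/-- The finitistic cotorsion dimension of a ring. -/
def FCD : ℕ∞ := sSup {d : ℕ∞ | d ≠ ⊤ ∧ ∃ M : ModuleCat.{u} R, cd R M = d}

/-- `R` is `n`-perfect if every flat `R`-module has projective dimension at most `n`. -/
def IsNPerfect (n : ℕ) : Prop :=
  ∀ M : ModuleCat.{u} R, Module.Flat R M → pd R M ≤ n

end

/-- The polynomial ring `ℂ[X,Y]`, realized as `(ℂ[X])[Y]`. -/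
abbrev Axy : Type := Polynomial (Polynomial ℂ)

/-- The rational function field `ℂ(X,Y)`. -/
abbrev Kxy : Type := FractionRing Axy

instance : (Ideal.span {Polynomial.X} : Ideal (Polynomial Kxy)).IsPrime :=
  (Ideal.span_singleton_prime Polynomial.X_ne_zero).mpr Polynomial.prime_X

/-- The discrete valuation ring `V = ℂ(X,Y)[Z]_{(Z)}`. -/
abbrev Vc : Type :=
  Localization.AtPrime (Ideal.span {Polynomial.X} : Ideal (Polynomial Kxy))

/-- The canonical embedding `ℂ[X,Y] → V`. -/
noncomputable def cxyToV : Axy →+* Vc :=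
  ((algebraMap (Polynomial Kxy) Vc).comp (Polynomial.C)).comp (algebraMap Axy Kxy)

section Homological
open CategoryTheory Opposite Limits

/-- Unbundled: projective dimension `< n`. -/
abbrev PDL (R : Type) [CommRing R] (M : Type) [AddCommGroup M] [Module R M] (n : ℕ) : Prop :=
  HasProjectiveDimensionLT (ModuleCat.of R M) n

section
variable {R : Type} [CommRing R] {M₁ M₂ M₃ : Type} [AddCommGroup M₁] [Module R M₁]
  [AddCommGroup M₂] [Module R M₂] [AddCommGroup M₃] [Module R M₃]

lemma ses_shortExact (f : M₁ →ₗ[R] M₂) (g : M₂ →ₗ[R] M₃) (hf : Function.Injective f)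
    (hfg : Function.Exact f g) (hg : Function.Surjective g) :
    (ShortComplex.mk (ModuleCat.ofHom f) (ModuleCat.ofHom g)
      (by ext x; exact hfg.apply_apply_eq_zero x)).ShortExact where
  exact := by
    rw [ShortComplex.ShortExact.moduleCat_exact_iff_function_exact]
    exact hfg
  mono_f := (ModuleCat.mono_iff_injective _).2 hf
  epi_g := (ModuleCat.epi_iff_surjective _).2 hg

lemma PDL_one_iff : PDL R M₁ 1 ↔ Module.Projective R M₁ := by
  rw [PDL, ← projective_iff_hasProjectiveDimensionLT_one, IsProjective.iff_projective]

lemma PDL_X3_iff (f : M₁ →ₗ[R] M₂) (g : M₂ →ₗ[R] M₃) (hf : Function.Injective f)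
    (hfg : Function.Exact f g) (hg : Function.Surjective g) [Module.Projective R M₂] (n : ℕ) :
    PDL R M₃ (n + 2) ↔ PDL R M₁ (n + 1) :=
  (ses_shortExact f g hf hfg hg).hasProjectiveDimensionLT_X₃_iff n
    ((IsProjective.iff_projective _).1 inferInstance)

lemma PDL_X1 (f : M₁ →ₗ[R] M₂) (g : M₂ →ₗ[R] M₃) (hf : Function.Injective f)
    (hfg : Function.Exact f g) (hg : Function.Surjective g) (n : ℕ)
    (h2 : PDL R M₂ n) (h3 : PDL R M₃ (n + 1)) : PDL R M₁ n :=
  (ses_shortExact f g hf hfg hg).hasProjectiveDimensionLT_X₁ n h2 h3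

lemma PDL_X3 (f : M₁ →ₗ[R] M₂) (g : M₂ →ₗ[R] M₃) (hf : Function.Injective f)
    (hfg : Function.Exact f g) (hg : Function.Surjective g) (n : ℕ)
    (h1 : PDL R M₁ n) (h2 : PDL R M₂ (n + 1)) : PDL R M₃ (n + 1) :=
  (ses_shortExact f g hf hfg hg).hasProjectiveDimensionLT_X₃ n h1 h2

lemma PDL_X2 (f : M₁ →ₗ[R] M₂) (g : M₂ →ₗ[R] M₃) (hf : Function.Injective f)
    (hfg : Function.Exact f g) (hg : Function.Surjective g) (n : ℕ)
    (h1 : PDL R M₁ n) (h3 : PDL R M₃ n) : PDL R M₂ n :=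
  (ses_shortExact f g hf hfg hg).hasProjectiveDimensionLT_X₂ n h1 h3

lemma PDL_equiv (e : M₁ ≃ₗ[R] M₂) (n : ℕ) (h : PDL R M₁ n) : PDL R M₂ n :=
  hasProjectiveDimensionLT_of_iso e.toModuleIso n

lemma PDL_mono {m n : ℕ} (hmn : m ≤ n) (h : PDL R M₁ m) : PDL R M₁ n :=
  hasProjectiveDimensionLT_of_ge _ _ _ hmn
end

section bridge
variable (R : Type) [CommRing R]

lemma extVanish_iff (X Y : ModuleCat.{0} R) (n : ℕ) :
    ExtVanish R X Y (n + 1) ↔ Subsingleton (Abelian.Ext X Y (n + 1)) := by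
  let P := projectiveResolution X
  have h1 : ExtVanish R X Y (n + 1) ↔
      ∀ f : P.complex.X (n + 1) ⟶ Y, P.complex.d (n + 2) (n + 1) ≫ f = 0 →
        ∃ g : P.complex.X n ⟶ Y, P.complex.d (n + 1) n ≫ g = f := by
    unfold ExtVanish
    rw [← ModuleCat.isZero_iff_subsingleton, (P.isoExt (R := R) (n + 1) Y).isZero_iff,
      ← HomologicalComplex.exactAt_iff_isZero_homology,
      HomologicalComplex.exactAt_iff' _ n (n + 1) (n + 2) (by simp) (by simp),
      ShortComplex.ShortExact.moduleCat_exact_iff_function_exact]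
    constructor
    · intro h f hf
      exact (h f).1 hf
    · intro h f
      constructor
      · intro hf
        exact h f hf
      · rintro ⟨g, hg⟩
        have key : ∀ (g : P.complex.X n ⟶ Y) (f : P.complex.X (n + 1) ⟶ Y),
            P.complex.d (n + 1) n ≫ g = f → P.complex.d (n + 2) (n + 1) ≫ f = 0 := by
          rintro g f rfl; simp
        exact key g f hg
  rw [h1]
  constructor
  · intro h
    refine subsingleton_of_forall_eq 0 fun α => ?_
    obtain ⟨f, hf, rfl⟩ := P.extMk_surjective α (n + 2) rfl
    rw [P.extMk_eq_zero_iff _ _ _ _ n rfl]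
    exact h f hf
  · intro h f hf
    rw [← P.extMk_eq_zero_iff f (n + 2) rfl hf n rfl]
    exact Subsingleton.elim _ _

lemma pdLE_iff (X : ModuleCat.{0} R) (n : ℕ) :
    pdLE R X n ↔ HasProjectiveDimensionLT X (n + 1) := by
  unfold pdLE
  simp only [extVanish_iff]
  constructor
  · intro h
    exact hasProjectiveDimensionLT_of_enoughInjectives X (n + 1) h
  · intro h N
    exact HasProjectiveDimensionLT.subsingleton X (n + 1) (n + 1) le_rfl N

lemma pd_le_iff (X : ModuleCat.{0} R) (n : ℕ) :
    pd R X ≤ n ↔ HasProjectiveDimensionLT X (n + 1) := by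
  unfold pd
  constructor
  · intro h
    have hne : ((fun n : ℕ => (n : ℕ∞)) '' {n : ℕ | pdLE R X n}).Nonempty := by
      by_contra hc
      rw [Set.not_nonempty_iff_eq_empty] at hc
      rw [hc] at h
      simp at h
    obtain ⟨m, hm, hm'⟩ := csInf_mem hne
    rw [← hm'] at h
    rw [Set.mem_ofPred_eq, pdLE_iff] at hm
    exact hasProjectiveDimensionLT_of_ge _ (m + 1) _ (by simpa using h)
  · intro h
    exact sInf_le ⟨n, (pdLE_iff R X n).2 h, rfl⟩

end bridge
end Homological

section TorShift
open CategoryTheory Opposite Limits MonoidalCategory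

section
variable {C : Type*} [Category C] [Abelian C]

/-- the augmentation of a projective resolution -/
noncomputable def resEps {Z : C} (Q : ProjectiveResolution Z) : Q.complex.X 0 ⟶ Z := Q.π.f 0

instance resEps_epi {Z : C} (Q : ProjectiveResolution Z) : Epi (resEps Q) :=
  inferInstanceAs (Epi (Q.π.f 0))

lemma resEps_zero {Z : C} (Q : ProjectiveResolution Z) : Q.complex.d 1 0 ≫ resEps Q = 0 :=
  Q.complex_d_comp_π_f_zero

lemma resEps_exact {Z : C} (Q : ProjectiveResolution Z) :
    (ShortComplex.mk _ _ (resEps_zero Q)).Exact := Q.exact₀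

lemma augRes_w (S : ShortComplex C) (Q : ProjectiveResolution S.X₁) :
    Q.complex.d 1 0 ≫ (resEps Q ≫ S.f) = 0 := by
  rw [← Category.assoc, resEps_zero, zero_comp]

/-- the spliced complex -/
noncomputable def augComplex (S : ShortComplex C) (Q : ProjectiveResolution S.X₁) :
    ChainComplex C ℕ :=
  ChainComplex.augment Q.complex (resEps Q ≫ S.f) (augRes_w S Q)

lemma aug_exact_zero (S : ShortComplex C) (hS : S.ShortExact) (Q : ProjectiveResolution S.X₁) :
    (ShortComplex.mk (resEps Q ≫ S.f : Q.complex.X 0 ⟶ S.X₂) S.g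
      (by rw [Category.assoc, S.zero, comp_zero])).Exact := by
  let α : ShortComplex.mk (resEps Q ≫ S.f : Q.complex.X 0 ⟶ S.X₂) S.g
      (by rw [Category.assoc, S.zero, comp_zero]) ⟶ S :=
    { τ₁ := resEps Q
      τ₂ := 𝟙 _
      τ₃ := 𝟙 _
      comm₁₂ := (Category.comp_id _).symm
      comm₂₃ := (Category.id_comp _).trans (Category.comp_id _).symm }
  have : Epi α.τ₁ := inferInstanceAs (Epi (resEps Q))
  have : IsIso α.τ₂ := inferInstanceAs (IsIso (𝟙 _))
  have : Mono α.τ₃ := inferInstanceAs (Mono (𝟙 _))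
  rw [ShortComplex.exact_iff_of_epi_of_isIso_of_mono α]
  exact hS.exact

lemma aug_exact_one (S : ShortComplex C) (hS : S.ShortExact) (Q : ProjectiveResolution S.X₁) :
    (ShortComplex.mk (Q.complex.d 1 0) (resEps Q ≫ S.f) (augRes_w S Q)).Exact := by
  let α : ShortComplex.mk _ _ (resEps_zero Q) ⟶
    ShortComplex.mk (Q.complex.d 1 0) (resEps Q ≫ S.f) (augRes_w S Q) :=
    { τ₁ := 𝟙 _
      τ₂ := 𝟙 _
      τ₃ := S.f
      comm₁₂ := (Category.id_comp _).trans (Category.comp_id _).symm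
      comm₂₃ := (Category.id_comp _) }
  have : Epi α.τ₁ := inferInstanceAs (Epi (𝟙 _))
  have : IsIso α.τ₂ := inferInstanceAs (IsIso (𝟙 _))
  have : Mono α.τ₃ := hS.mono_f
  rw [← ShortComplex.exact_iff_of_epi_of_isIso_of_mono α]
  exact resEps_exact Q

lemma augComplex_exactAt (S : ShortComplex C) (hS : S.ShortExact) (Q : ProjectiveResolution S.X₁)
    (n : ℕ) : (augComplex S Q).ExactAt (n + 1) := by
  rw [HomologicalComplex.exactAt_iff' _ (n + 2) (n + 1) n (by simp) (by simp)]
  match n with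
  | 0 => exact aug_exact_one S hS Q
  | n + 1 => exact Q.exact_succ n

/-- the augmentation map of the spliced complex -/
noncomputable def augPi (S : ShortComplex C) (Q : ProjectiveResolution S.X₁) :
    augComplex S Q ⟶ (ChainComplex.single₀ C).obj S.X₃ :=
  (ChainComplex.toSingle₀Equiv _ _).symm ⟨S.g, by
    change (resEps Q ≫ S.f) ≫ S.g = 0
    rw [Category.assoc, S.zero, comp_zero]⟩

lemma augPi_f_zero (S : ShortComplex C) (Q : ProjectiveResolution S.X₁) :
    (augPi S Q).f 0 = S.g := by
  unfold augPi
  exact ChainComplex.toSingle₀Equiv_symm_apply_f_zero (C := augComplex S Q) _ _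

/-- splice a projective resolution onto a short exact sequence -/
noncomputable def augRes (S : ShortComplex C) (hS : S.ShortExact) [Projective S.X₂]
    (Q : ProjectiveResolution S.X₁) : ProjectiveResolution S.X₃ where
  complex := augComplex S Q
  projective := fun n => match n with
    | 0 => inferInstanceAs (Projective S.X₂)
    | n + 1 => Q.projective n
  π := augPi S Q
  quasiIso := ⟨fun n => by
    cases n
    · rw [ChainComplex.quasiIsoAt₀_iff, ShortComplex.quasiIso_iff_of_zeros']
      · refine (ShortComplex.exact_and_epi_g_iff_of_iso ?_).2
          ⟨aug_exact_zero S hS Q, hS.epi_g⟩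
        refine ShortComplex.isoMk (Iso.refl _) (Iso.refl _) (Iso.refl _)
          ((Category.id_comp _).trans (Category.comp_id _).symm)
          ((Category.id_comp _).trans ?_)
        exact (augPi_f_zero S Q).symm.trans (Category.comp_id _).symm
      all_goals rfl
    · rw [quasiIsoAt_iff_exactAt']
      · apply augComplex_exactAt S hS
      · apply ChainComplex.exactAt_succ_single_obj⟩
end
end TorShift

section TorUnb
open CategoryTheory Opposite Limits MonoidalCategory

variable {R : Type} [CommRing R]

lemma torVanish_iff_res (M N : ModuleCat.{0} R) (P : ProjectiveResolution N) (n : ℕ) :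
    TorVanish R M N (n + 1) ↔
      Function.Exact (LinearMap.lTensor M (P.complex.d (n + 2) (n + 1)).hom)
        (LinearMap.lTensor M (P.complex.d (n + 1) n).hom) := by
  unfold TorVanish
  rw [← ModuleCat.isZero_iff_subsingleton, CategoryTheory.Tor_obj,
    (P.isoLeftDerivedObj ((tensoringLeft (ModuleCat R)).obj M) (n + 1)).isZero_iff]
  refine (HomologicalComplex.exactAt_iff_isZero_homology _ _).symm.trans ?_
  rw [HomologicalComplex.exactAt_iff' _ (n + 2) (n + 1) n (by simp) (by simp),
      ShortComplex.ShortExact.moduleCat_exact_iff_function_exact]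
  rfl

/-- Unbundled vanishing of Tor. -/
abbrev TV (R : Type) [CommRing R] (M N : Type) [AddCommGroup M] [Module R M]
    [AddCommGroup N] [Module R N] (n : ℕ) : Prop :=
  TorVanish R (ModuleCat.of R M) (ModuleCat.of R N) n

variable {M₁ M₂ M₃ : Type} [AddCommGroup M₁] [Module R M₁]
  [AddCommGroup M₂] [Module R M₂] [AddCommGroup M₃] [Module R M₃]
  (M : Type) [AddCommGroup M] [Module R M]

lemma TV_succ (f : M₁ →ₗ[R] M₂) (g : M₂ →ₗ[R] M₃) (hf : Function.Injective f)
    (hfg : Function.Exact f g) (hg : Function.Surjective g) [Module.Projective R M₂] (n : ℕ) :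
    TV R M M₃ (n + 2) ↔ TV R M M₁ (n + 1) := by
  have hS := ses_shortExact f g hf hfg hg
  let Q := projectiveResolution (ModuleCat.of R M₁)
  have hp : Projective (ModuleCat.of R M₂) := (IsProjective.iff_projective _).1 inferInstance
  rw [TV, TV, torVanish_iff_res _ _ Q, torVanish_iff_res _ _ (@augRes _ _ _ _ hS hp Q)]
  rfl

lemma TV_one (f : M₁ →ₗ[R] M₂) (g : M₂ →ₗ[R] M₃) (hf : Function.Injective f)
    (hfg : Function.Exact f g) (hg : Function.Surjective g) [Module.Projective R M₂] :
    TV R M M₃ 1 ↔ Function.Injective (LinearMap.lTensor M f) := by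
  have hS := ses_shortExact f g hf hfg hg
  let Q := projectiveResolution (ModuleCat.of R M₁)
  have hp : Projective (ModuleCat.of R M₂) := (IsProjective.iff_projective _).1 inferInstance
  rw [TV, torVanish_iff_res _ _ (@augRes _ _ _ _ hS hp Q) 0]
  let d : Q.complex.X 1 →ₗ[R] Q.complex.X 0 := (Q.complex.d 1 0).hom
  let e : Q.complex.X 0 →ₗ[R] M₁ := (resEps Q).hom
  have he : Function.Surjective e := (ModuleCat.epi_iff_surjective _).1 (resEps_epi Q)
  have hde : Function.Exact d e :=
    (ShortComplex.ShortExact.moduleCat_exact_iff_function_exact _).1 (resEps_exact Q)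
  change Function.Exact (LinearMap.lTensor M d) (LinearMap.lTensor M (f.comp e)) ↔ _
  have hx := lTensor_exact M hde he
  have hs : Function.Surjective (LinearMap.lTensor M e) := LinearMap.lTensor_surjective M he
  rw [LinearMap.lTensor_comp]
  constructor
  · intro h
    rw [injective_iff_map_eq_zero]
    intro x hx0
    obtain ⟨y, rfl⟩ := hs x
    exact (hx y).2 ((h y).1 hx0)
  · intro h y
    rw [← hx y]
    simp only [LinearMap.comp_apply]
    exact map_eq_zero_iff _ h

lemma fdLE_mono_succ (X : ModuleCat.{0} R) (n : ℕ) (h : fdLE R X n) : fdLE R X (n + 1) := by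
  intro N
  let g : (N →₀ R) →ₗ[R] N := Finsupp.linearCombination R id
  have hg : Function.Surjective g := Finsupp.linearCombination_id_surjective R N
  exact (TV_succ X (LinearMap.ker g).subtype g (Submodule.subtype_injective _)
    (LinearMap.exact_subtype_ker_map g) hg n).2 (h (ModuleCat.of R (LinearMap.ker g)))

lemma fdLE_mono (X : ModuleCat.{0} R) {m n : ℕ} (hmn : m ≤ n) (h : fdLE R X m) : fdLE R X n := by
  induction n, hmn using Nat.le_induction with
  | base => exact h
  | succ n _ ih => exact fdLE_mono_succ X n ih

lemma fd_le_iff (X : ModuleCat.{0} R) (n : ℕ) : fd R X ≤ n ↔ fdLE R X n := by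
  unfold fd
  constructor
  · intro h
    have hne : ((fun n : ℕ => (n : ℕ∞)) '' {n : ℕ | fdLE R X n}).Nonempty := by
      by_contra hc
      rw [Set.not_nonempty_iff_eq_empty] at hc
      rw [hc] at h
      simp at h
    obtain ⟨m, hm, hm'⟩ := csInf_mem hne
    rw [← hm'] at h
    exact fdLE_mono X (by simpa using h) hm
  · intro h
    exact sInf_le ⟨n, h, rfl⟩

end TorUnb

section PolyDim
open TensorProduct

/-- every module has projective dimension `< n` -/
def GLD (R : Type) [CommRing R] (n : ℕ) : Prop :=
  ∀ (M : Type) [AddCommGroup M] [Module R M], PDL R M n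

/-- The canonical free cover. -/
noncomputable abbrev fcov (R : Type) [CommRing R] (M : Type) [AddCommGroup M] [Module R M] :
    (M →₀ R) →ₗ[R] M := Finsupp.linearCombination R id

lemma fcov_surj (R : Type) [CommRing R] (M : Type) [AddCommGroup M] [Module R M] :
    Function.Surjective (fcov R M) := Finsupp.linearCombination_id_surjective R M

lemma PDL_ker {R : Type} [CommRing R] {P M : Type} [AddCommGroup M] [Module R M]
    [AddCommGroup P] [Module R P] [Module.Projective R P] (g : P →ₗ[R] M)
    (hg : Function.Surjective g) (n : ℕ) :
    PDL R M (n + 2) ↔ PDL R (LinearMap.ker g) (n + 1) :=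
  PDL_X3_iff (LinearMap.ker g).subtype g (Submodule.subtype_injective _)
    (LinearMap.exact_subtype_ker_map g) hg n

/-- flat base change does not increase the projective dimension -/
lemma PDL_baseChange {R S : Type} [CommRing R] [CommRing S] [Algebra R S] [Module.Flat R S]
    (n : ℕ) : ∀ (M : Type) [AddCommGroup M] [Module R M], PDL R M (n + 1) →
      PDL S (S ⊗[R] M) (n + 1) := by
  induction n with
  | zero =>
    intro M _ _ h
    rw [zero_add, PDL_one_iff] at h ⊢
    infer_instance
  | succ n ih =>
    intro M _ _ h
    have h1 := ih _ ((PDL_ker (fcov R M) (fcov_surj R M) n).1 h)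
    refine (PDL_X3_iff ((LinearMap.ker (fcov R M)).subtype.baseChange S)
      ((fcov R M).baseChange S) ?_ ?_ ?_ n).2 h1
    · exact Module.Flat.lTensor_preserves_injective_linearMap _ (Submodule.subtype_injective _)
    · exact lTensor_exact S (LinearMap.exact_subtype_ker_map _) (fcov_surj R M)
    · exact LinearMap.lTensor_surjective S (fcov_surj R M)

open Polynomial

section
variable {B : Type} [CommRing B] (M : Type) [AddCommGroup M] [Module B[X] M] [Module B M]
  [IsScalarTower B B[X] M]

/-- multiplication by a polynomial -/
noncomputable abbrev pmul (p : B[X]) : M →ₗ[B] M := Algebra.lsmul B B M p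

/-- `p ⊗ m ↦ X p ⊗ m - p ⊗ X m` -/
noncomputable def psi : B[X] ⊗[B] M →ₗ[B[X]] B[X] ⊗[B] M :=
  LinearMap.lsmul B[X] (B[X] ⊗[B] M) X - (pmul M X).baseChange B[X]

noncomputable def eps : B[X] ⊗[B] M →ₗ[B[X]] M := LinearMap.liftBaseChange B[X] LinearMap.id

noncomputable def hh : B[X] ⊗[B] M →ₗ[B] B[X] ⊗[B] M :=
  TensorProduct.lift (Polynomial.lsum fun n => LinearMap.toSpanSingleton B _
    (∑ i ∈ Finset.range n, (TensorProduct.mk B B[X] M (X ^ i)).comp (pmul M (X ^ (n - 1 - i)))))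

lemma hh_tmul (n : ℕ) (m : M) : hh M ((X ^ n : B[X]) ⊗ₜ[B] m) =
    ∑ i ∈ Finset.range n, (X ^ i : B[X]) ⊗ₜ[B] ((X ^ (n - 1 - i) : B[X]) • m) := by
  rw [hh, TensorProduct.lift.tmul, Polynomial.lsum_apply, ← monomial_one_right_eq_X_pow,
    Polynomial.sum_monomial_index]
  · rw [LinearMap.toSpanSingleton_apply, one_smul, LinearMap.sum_apply]
    rfl
  · simp

lemma psi_tmul (p : B[X]) (m : M) : psi M (p ⊗ₜ[B] m) =
    (X * p) ⊗ₜ[B] m - p ⊗ₜ[B] ((X : B[X]) • m) := by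
  simp [psi, smul_tmul']

lemma eps_tmul (p : B[X]) (m : M) : eps M (p ⊗ₜ[B] m) = p • m := by
  simp [eps]

lemma pt_ext {N : Type} [AddCommGroup N] [Module B N] (f g : B[X] ⊗[B] M →ₗ[B] N)
    (h : ∀ (n : ℕ) (m : M), f ((X ^ n : B[X]) ⊗ₜ[B] m) = g ((X ^ n : B[X]) ⊗ₜ[B] m)) : f = g := by
  apply TensorProduct.ext
  apply Polynomial.lhom_ext'
  intro n
  ext m
  simpa [monomial_one_right_eq_X_pow] using h n m

lemma hh_psi (x : B[X] ⊗[B] M) : hh M (psi M x) = x := by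
  have : (hh M).comp ((psi M).restrictScalars B) = LinearMap.id := by
    apply pt_ext
    intro n m
    simp only [LinearMap.comp_apply, LinearMap.restrictScalars_apply, psi_tmul, map_sub,
      ← pow_succ', hh_tmul, LinearMap.id_apply]
    rw [Finset.sum_range_succ]
    simp only [Nat.add_sub_cancel, Nat.sub_self, pow_zero, one_smul]
    rw [add_sub_right_comm, add_eq_right, sub_eq_zero]
    apply Finset.sum_congr rfl
    intro i hi
    rw [Finset.mem_range] at hi
    rw [smul_smul, ← pow_succ]
    congr 3
    omega
  exact LinearMap.congr_fun this x

lemma psi_hh (x : B[X] ⊗[B] M) : psi M (hh M x) + 1 ⊗ₜ eps M x = x := by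
  have : ((psi M).restrictScalars B).comp (hh M) +
     (TensorProduct.mk B B[X] M 1).comp ((eps M).restrictScalars B) = LinearMap.id := by
    apply pt_ext
    intro n m
    simp only [LinearMap.add_apply, LinearMap.comp_apply, LinearMap.restrictScalars_apply, hh_tmul,
      map_sum, psi_tmul, LinearMap.id_apply, eps_tmul, mk_apply]
    have : ∀ i ∈ Finset.range n, (X * X ^ i : B[X]) ⊗ₜ[B] ((X ^ (n - 1 - i) : B[X]) • m) -
        (X ^ i : B[X]) ⊗ₜ[B] ((X : B[X]) • ((X ^ (n - 1 - i) : B[X]) • m)) =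
        (X ^ (i + 1) : B[X]) ⊗ₜ[B] ((X ^ (n - (i + 1)) : B[X]) • m) -
        (X ^ i : B[X]) ⊗ₜ[B] ((X ^ (n - i) : B[X]) • m) := by
      intro i hi
      rw [Finset.mem_range] at hi
      rw [smul_smul, ← pow_succ', ← pow_succ']
      congr 4 <;> omega
    rw [Finset.sum_congr rfl this,
      Finset.sum_range_sub (fun i => (X ^ i : B[X]) ⊗ₜ[B] ((X ^ (n - i) : B[X]) • m))]
    simp
  exact LinearMap.congr_fun this x

lemma eps_psi (x : B[X] ⊗[B] M) : eps M (psi M x) = 0 := by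
  induction x with
  | zero => simp
  | tmul p m => rw [psi_tmul, map_sub, eps_tmul, eps_tmul, mul_comm, mul_smul, sub_self]
  | add x y hx hy => rw [map_add, map_add, hx, hy, add_zero]

end

lemma GLD_poly (B : Type) [CommRing B] (n : ℕ) (h : GLD B (n + 1)) : GLD B[X] (n + 2) := by
  intro M _ _
  let : Module B M := Module.compHom M (C : B →+* B[X])
  have : IsScalarTower B B[X] M := ⟨fun b p m => by
    change (b • p) • m = (C b : B[X]) • (p • m)
    rw [smul_smul, Polynomial.smul_eq_C_mul]⟩
  have h1 : PDL B[X] (B[X] ⊗[B] M) (n + 1) := PDL_baseChange n M (h M)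
  refine PDL_X3 (psi M) (eps M) ?_ ?_ ?_ (n + 1) h1 (PDL_mono (by omega) h1)
  · exact Function.LeftInverse.injective (hh_psi M)
  · intro x
    constructor
    · intro hx
      refine ⟨hh M x, ?_⟩
      have := psi_hh M x
      rwa [hx, tmul_zero, add_zero] at this
    · rintro ⟨y, rfl⟩
      exact eps_psi M y
  · intro m
    exact ⟨1 ⊗ₜ m, by rw [eps_tmul, one_smul]⟩

lemma GLD_field (k : Type) [Field k] : GLD k 1 := by
  intro M _ _
  rw [PDL_one_iff]
  infer_instance

lemma GLD_Axy : GLD Axy 3 := GLD_poly _ 1 (GLD_poly _ 0 (GLD_field ℂ))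

/-- Localizations have smaller global dimension. -/
lemma GLD_loc (R S : Type) [CommRing R] [CommRing S] [Algebra R S] (T : Submonoid R)
    [IsLocalization T S] (n : ℕ) (h : GLD R (n + 1)) : GLD S (n + 1) := by
  intro M _ _
  let : Module R M := Module.compHom M (algebraMap R S)
  have : IsScalarTower R S M := ⟨fun b p m => by
    change (b • p) • m = (algebraMap R S b) • (p • m)
    rw [smul_smul, Algebra.smul_def]⟩
  have : Module.Flat R S := IsLocalization.flat S T
  have h1 : PDL S (S ⊗[R] M) (n + 1) := PDL_baseChange n M (h M)
  have hl : IsLocalizedModule T (LinearMap.id : M →ₗ[R] M) :=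
    isLocalizedModule_id T M S
  have hb := (isLocalizedModule_iff_isBaseChange T S (LinearMap.id : M →ₗ[R] M)).1 hl
  exact PDL_equiv hb.equiv _ h1

lemma GLD_Vc : GLD Vc 2 :=
  GLD_loc (Polynomial Kxy) Vc
    (Ideal.primeCompl (Ideal.span {Polynomial.X} : Ideal (Polynomial Kxy))) 1
    (GLD_poly _ 0 (GLD_field Kxy))

end PolyDim

section Milnor
open TensorProduct

section
variable {R A V K : Type} [CommRing R] [CommRing A] [CommRing V] [CommRing K]
  [Algebra R A] [Algebra R V] [Algebra R K] [Algebra V K] [IsScalarTower R V K]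

lemma mk_one_surj (hA : Function.Surjective (algebraMap R A)) (P : Type) [AddCommGroup P]
    [Module R P] : Function.Surjective (TensorProduct.mk R A P 1) := by
  intro x
  induction x with
  | zero => exact ⟨0, map_zero _⟩
  | tmul a p =>
    obtain ⟨r, rfl⟩ := hA a
    exact ⟨r • p, by rw [mk_apply, ← smul_tmul, Algebra.smul_def, mul_one]⟩
  | add x y hx hy =>
    obtain ⟨a, rfl⟩ := hx
    obtain ⟨b, rfl⟩ := hy
    exact ⟨a + b, map_add _ _ _⟩

lemma mk_one_inj (hRV : Function.Injective (algebraMap R V)) (P : Type) [AddCommGroup P]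
    [Module R P] [Module.Flat R P] : Function.Injective (TensorProduct.mk R V P 1) := by
  have h : TensorProduct.mk R V P 1 =
      (LinearMap.rTensor P (Algebra.linearMap R V)).comp
        (TensorProduct.lid R P).symm.toLinearMap := by
    ext p; simp
  rw [h, LinearMap.coe_comp]
  exact (Module.Flat.rTensor_preserves_injective_linearMap (Algebra.linearMap R V) hRV).comp
    (TensorProduct.lid R P).symm.injective

theorem milnor (α : A →ₗ[R] K) (hα : α 1 = 1)
    (hA : Function.Surjective (algebraMap R A))
    (hVK : Function.Surjective (algebraMap V K))
    (hJ : ∀ v : V, algebraMap V K v = 0 → ∃ r : R, algebraMap R V r = v)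
    (hRV : Function.Injective (algebraMap R V))
    {P Q : Type} [AddCommGroup P] [Module R P] [AddCommGroup Q] [Module R Q] [Module.Flat R P]
    (f : P →ₗ[R] Q) (hf : Function.Surjective f)
    (σA : A ⊗[R] Q →ₗ[R] A ⊗[R] P) (hσ : ∀ x, LinearMap.lTensor A f (σA x) = x)
    (hproj : Module.Projective V (V ⊗[R] Q))
    (hQ : Function.Injective (TensorProduct.mk R V Q 1)) :
    ∃ s : Q →ₗ[R] P, f.comp s = LinearMap.id := by
  let τ : Q →ₗ[R] K ⊗[R] P :=
    (LinearMap.rTensor P α).comp (σA.comp (TensorProduct.mk R A Q 1))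
  have hτ : ∀ q, LinearMap.lTensor K f (τ q) = 1 ⊗ₜ q := by
    intro q
    have h1 : ∀ x : A ⊗[R] P, LinearMap.lTensor K f (LinearMap.rTensor P α x) =
        LinearMap.rTensor Q α (LinearMap.lTensor A f x) := by
      intro x
      rw [← LinearMap.comp_apply, ← LinearMap.comp_apply, LinearMap.lTensor_comp_rTensor,
        LinearMap.rTensor_comp_lTensor]
    simp only [τ, LinearMap.comp_apply]
    rw [h1, hσ, mk_apply, LinearMap.rTensor_tmul, hα]
  let τV : V ⊗[R] Q →ₗ[V] K ⊗[R] P := LinearMap.liftBaseChange V τ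
  let ρP : V ⊗[R] P →ₗ[V] K ⊗[R] P :=
    AlgebraTensorModule.map (Algebra.linearMap V K) LinearMap.id
  let ρQ : V ⊗[R] Q →ₗ[V] K ⊗[R] Q :=
    AlgebraTensorModule.map (Algebra.linearMap V K) LinearMap.id
  let fK : K ⊗[R] P →ₗ[V] K ⊗[R] Q :=
    AlgebraTensorModule.map (LinearMap.id : K →ₗ[V] K) f
  let fV : V ⊗[R] P →ₗ[V] V ⊗[R] Q := f.baseChange V
  have hfV : Function.Surjective fV := LinearMap.lTensor_surjective V hf
  have hfK : ∀ x, fK x = LinearMap.lTensor K f x := fun x => rfl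
  have c1 : ∀ x, fK (τV x) = ρQ x := by
    intro x
    induction x with
    | zero => simp
    | tmul v q =>
      rw [show τV (v ⊗ₜ q) = v • τ q by simp [τV], map_smul, hfK, hτ, smul_tmul']
      simp [ρQ, Algebra.smul_def]
    | add x y hx hy => simp only [map_add, hx, hy]
  have c2 : ∀ x, fK (ρP x) = ρQ (fV x) := by
    intro x
    induction x with
    | zero => simp
    | tmul v q => simp [fK, ρP, ρQ, fV]
    | add x y hx hy => simp only [map_add, hx, hy]
  let Φ : V ⊗[R] P →ₗ[V] (K ⊗[R] P) × (V ⊗[R] Q) := ρP.prod fV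
  let Θ : V ⊗[R] Q →ₗ[V] (K ⊗[R] P) × (V ⊗[R] Q) := τV.prod LinearMap.id
  have hΘ : ∀ x, Θ x ∈ LinearMap.range Φ := by
    intro x
    obtain ⟨y, rfl⟩ := hfV x
    have h0 : LinearMap.lTensor K f (τV (fV y) - ρP y) = 0 := by
      rw [← hfK, map_sub, c1, c2, sub_self]
    obtain ⟨z, hz⟩ := (lTensor_exact K (LinearMap.exact_subtype_ker_map f) hf _).1 h0
    obtain ⟨z', rfl⟩ := LinearMap.rTensor_surjective (LinearMap.ker f)
      (g := (IsScalarTower.toAlgHom R V K).toLinearMap) (fun k => hVK k) z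
    refine ⟨y + LinearMap.lTensor V (LinearMap.ker f).subtype z', ?_⟩
    ext1
    · change ρP (y + _) = τV (fV y)
      have h2 : ∀ w : V ⊗[R] (LinearMap.ker f), ρP (LinearMap.lTensor V (LinearMap.ker f).subtype w) =
          LinearMap.lTensor K (LinearMap.ker f).subtype
            (LinearMap.rTensor _ (IsScalarTower.toAlgHom R V K).toLinearMap w) := by
        intro w
        induction w with
        | zero => simp
        | tmul v q => simp [ρP]
        | add x y hx hy => simp only [map_add, hx, hy]
      rw [map_add, h2, hz, add_sub_cancel]
    · change fV (y + _) = fV y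
      have h3 : fV (LinearMap.lTensor V (LinearMap.ker f).subtype z') = 0 :=
        (lTensor_exact V (LinearMap.exact_subtype_ker_map f) hf _).2 ⟨z', rfl⟩
      rw [map_add, h3, add_zero]
  obtain ⟨σ, hσ'⟩ := Module.projective_lifting_property Φ.rangeRestrict
    (Θ.codRestrict _ hΘ) Φ.surjective_rangeRestrict
  have hs : ∀ x, ρP (σ x) = τV x ∧ fV (σ x) = x := by
    intro x
    have := congrArg Subtype.val (LinearMap.congr_fun hσ' x)
    exact ⟨congrArg Prod.fst this, congrArg Prod.snd this⟩
  have hmem : ∀ q, σ (1 ⊗ₜ q) ∈ LinearMap.range (TensorProduct.mk R V P 1) := by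
    intro q
    obtain ⟨p, hp⟩ := mk_one_surj hA P (σA (1 ⊗ₜ q))
    have h1 : ρP (σ (1 ⊗ₜ q) - 1 ⊗ₜ p) = 0 := by
      rw [map_sub, (hs _).1]
      have : τV (1 ⊗ₜ q) = τ q := by simp [τV]
      rw [this]
      simp only [τ, LinearMap.comp_apply]
      rw [mk_apply, ← hp]
      simp [ρP, hα]
    have hex : Function.Exact
        (LinearMap.ker (IsScalarTower.toAlgHom R V K).toLinearMap).subtype
        (IsScalarTower.toAlgHom R V K).toLinearMap := LinearMap.exact_subtype_ker_map _
    have h2 : LinearMap.rTensor P (IsScalarTower.toAlgHom R V K).toLinearMap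
        (σ (1 ⊗ₜ q) - 1 ⊗ₜ p) = 0 := h1
    obtain ⟨z, hz⟩ := (rTensor_exact P hex (fun k => hVK k) _).1 h2
    have h3 : ∀ z, LinearMap.rTensor P
        (LinearMap.ker (IsScalarTower.toAlgHom R V K).toLinearMap).subtype z ∈
        LinearMap.range (TensorProduct.mk R V P 1) := by
      intro z
      induction z with
      | zero => rw [map_zero]; exact Submodule.zero_mem _
      | tmul v p =>
        obtain ⟨r, hr⟩ := hJ v.1 v.2
        refine ⟨r • p, ?_⟩
        rw [LinearMap.rTensor_tmul, Submodule.subtype_apply, ← hr, mk_apply, ← smul_tmul,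
          Algebra.smul_def, mul_one]
      | add x y hx hy => rw [map_add]; exact Submodule.add_mem _ hx hy
    have h4 := h3 z
    rw [hz] at h4
    have h5 := Submodule.add_mem _ h4 ⟨p, rfl⟩
    rwa [mk_apply, sub_add_cancel] at h5
  let jP := LinearEquiv.ofInjective (TensorProduct.mk R V P 1) (mk_one_inj hRV P)
  let σ' : Q →ₗ[R] LinearMap.range (TensorProduct.mk R V P 1) :=
    LinearMap.codRestrict _ ((σ.restrictScalars R).comp (TensorProduct.mk R V Q 1)) hmem
  refine ⟨jP.symm.toLinearMap.comp σ', ?_⟩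
  ext q
  apply hQ
  have h6 : TensorProduct.mk R V P 1 (jP.symm (σ' q)) = σ (1 ⊗ₜ q) :=
    congrArg Subtype.val (jP.apply_symm_apply (σ' q))
  have h7 := (hs (1 ⊗ₜ q)).2
  rw [← h6] at h7
  exact h7

end
end Milnor

section Setup
open TensorProduct

/-- The abstract pullback situation. -/
structure PB (R A V K : Type) [CommRing R] [CommRing A] [CommRing V] [CommRing K]
    [Algebra R A] [Algebra R V] [Algebra R K] [Algebra V K] [IsScalarTower R V K]
    (S : Submonoid R) : Prop where
  dom : IsDomain R
  ded : IsDedekindDomain V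
  hα : ∃ α : A →ₗ[R] K, α 1 = 1
  hA : Function.Surjective (algebraMap R A)
  hVK : Function.Surjective (algebraMap V K)
  hJ : ∀ v : V, algebraMap V K v = 0 → ∃ r : R, algebraMap R V r = v
  hRV : Function.Injective (algebraMap R V)
  loc : IsLocalization S V
  hS0 : (0 : R) ∉ S
  hdir : ∀ j₁ j₂ : R, algebraMap R A j₁ = 0 → algebraMap R A j₂ = 0 →
    ∃ j, algebraMap R A j = 0 ∧ j ∣ j₁ ∧ j ∣ j₂
  hS : ∀ s ∈ S, ∀ j : R, algebraMap R A j = 0 → ∃ j', algebraMap R A j' = 0 ∧ j = j' * s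
  glA : GLD A 3
  glV : GLD V 2

namespace PB
variable {R A V K : Type} [CommRing R] [CommRing A] [CommRing V] [CommRing K]
    [Algebra R A] [Algebra R V] [Algebra R K] [Algebra V K] [IsScalarTower R V K]
    {S : Submonoid R}

/-- A technical divisibility condition on the annihilators. -/
def JGood (R A Q : Type) [CommRing R] [CommRing A] [Algebra R A] [AddCommGroup Q] [Module R Q] :
    Prop := ∀ (j : R) (q : Q), algebraMap R A j = 0 → j • q = 0 →
      ∃ j' r : R, algebraMap R A j' = 0 ∧ j = j' * r ∧ r • q = 0

lemma jgood_tf [IsDomain R] (A Q : Type) [CommRing A] [Algebra R A] [AddCommGroup Q] [Module R Q]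
    [Module.IsTorsionFree R Q] : JGood R A Q := by
  intro j q hj hq
  rcases smul_eq_zero.1 hq with rfl | rfl
  · exact ⟨0, 0, map_zero _, by simp, by simp⟩
  · exact ⟨j, 1, hj, by simp, by simp⟩

lemma jgood_tors (h : PB R A V K S) {Q : Type} [AddCommGroup Q] [Module R Q]
    (hQ : ∀ q : Q, ∃ s ∈ S, s • q = 0) : JGood R A Q := by
  intro j q hj _
  obtain ⟨s, hs, hsq⟩ := hQ q
  obtain ⟨j', hj', e⟩ := h.hS s hs j hj
  exact ⟨j', s, hj', e, hsq⟩

lemma ker_mk (h : PB R A V K S) {P : Type} [AddCommGroup P] [Module R P] (p : P)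
    (hp : (1 : A) ⊗ₜ[R] p = 0) : ∃ (j : R) (p' : P), algebraMap R A j = 0 ∧ p = j • p' := by
  have hex : Function.Exact (LinearMap.ker (Algebra.linearMap R A)).subtype
    (Algebra.linearMap R A) := LinearMap.exact_subtype_ker_map _
  have h1 : LinearMap.rTensor P (Algebra.linearMap R A) ((1 : R) ⊗ₜ p) = 0 := by
    simpa using hp
  obtain ⟨z, hz⟩ := (rTensor_exact P hex h.hA _).1 h1
  have key : ∀ z : (LinearMap.ker (Algebra.linearMap R A)) ⊗[R] P, ∃ (j : R) (p' : P),
      algebraMap R A j = 0 ∧ TensorProduct.lid R P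
        (LinearMap.rTensor P (LinearMap.ker (Algebra.linearMap R A)).subtype z) = j • p' := by
    intro z
    induction z with
    | zero => exact ⟨0, 0, by simp, by simp⟩
    | tmul j p => exact ⟨j.1, p, j.2, by simp⟩
    | add x y hx hy =>
      obtain ⟨j₁, p₁, hj₁, e₁⟩ := hx
      obtain ⟨j₂, p₂, hj₂, e₂⟩ := hy
      obtain ⟨j, hj, ⟨a, rfl⟩, ⟨b, rfl⟩⟩ := h.hdir j₁ j₂ hj₁ hj₂
      refine ⟨j, a • p₁ + b • p₂, hj, ?_⟩
      rw [map_add, map_add, e₁, e₂, smul_add, smul_smul, smul_smul]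
  obtain ⟨j, p', hj, e⟩ := key z
  refine ⟨j, p', hj, ?_⟩
  rw [← e, hz]
  simp

lemma A_inj (h : PB R A V K S) {P Q : Type} [AddCommGroup P] [Module R P] [AddCommGroup Q]
    [Module R Q] (g : P →ₗ[R] Q) (hQ : JGood R A Q) :
    Function.Injective (LinearMap.lTensor A (LinearMap.ker g).subtype) := by
  rw [injective_iff_map_eq_zero]
  intro x hx
  obtain ⟨q, rfl⟩ := mk_one_surj h.hA _ x
  rw [mk_apply, LinearMap.lTensor_tmul] at hx
  obtain ⟨j, p, hj, e⟩ := h.ker_mk _ hx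
  have hgp : j • g p = 0 := by
    rw [← map_smul, ← e]
    exact q.2
  obtain ⟨j', r, hj', rfl, hr⟩ := hQ j (g p) hj hgp
  have hmem : r • p ∈ LinearMap.ker g := by rw [LinearMap.mem_ker, map_smul, hr]
  have : q = j' • (⟨r • p, hmem⟩ : LinearMap.ker g) := by
    apply Subtype.ext
    rw [← Submodule.subtype_apply, e, mul_smul]
    rfl
  rw [mk_apply, this, ← smul_tmul, Algebra.smul_def, hj', zero_mul, zero_tmul]

lemma A_ker_iff (h : PB R A V K S) {P Q : Type} [AddCommGroup P] [Module R P] [AddCommGroup Q]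
    [Module R Q] [Module.Projective R P] (g : P →ₗ[R] Q) (hg : Function.Surjective g)
    (hQ : JGood R A Q) (n : ℕ) :
    PDL A (A ⊗[R] Q) (n + 2) ↔ PDL A (A ⊗[R] LinearMap.ker g) (n + 1) :=
  PDL_X3_iff ((LinearMap.ker g).subtype.baseChange A)
      (g.baseChange A) (h.A_inj g hQ)
      (_root_.lTensor_exact A (LinearMap.exact_subtype_ker_map _) hg)
      (LinearMap.lTensor_surjective A hg) n

lemma V_ker_iff (h : PB R A V K S) {P Q : Type} [AddCommGroup P] [Module R P] [AddCommGroup Q]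
    [Module R Q] [Module.Projective R P] (g : P →ₗ[R] Q) (hg : Function.Surjective g) (n : ℕ) :
    PDL V (V ⊗[R] Q) (n + 2) ↔ PDL V (V ⊗[R] LinearMap.ker g) (n + 1) := by
  have := h.loc
  have : Module.Flat R V := IsLocalization.flat V S
  exact PDL_X3_iff ((LinearMap.ker g).subtype.baseChange V)
      (g.baseChange V)
      (Module.Flat.lTensor_preserves_injective_linearMap _ (Submodule.subtype_injective _))
      (_root_.lTensor_exact V (LinearMap.exact_subtype_ker_map _) hg)
      (LinearMap.lTensor_surjective V hg) n

lemma locMod (h : PB R A V K S) (Q : Type) [AddCommGroup Q] [Module R Q] :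
    IsLocalizedModule S (TensorProduct.mk R V Q 1) := by
  have := h.loc
  exact (isLocalizedModule_iff_isBaseChange S V _).2 (TensorProduct.isBaseChange R Q V)

lemma V_mk_inj (h : PB R A V K S) (Q : Type) [AddCommGroup Q] [Module R Q]
    [Module.IsTorsionFree R Q] : Function.Injective (TensorProduct.mk R V Q 1) := by
  have := h.dom
  have := h.locMod Q
  rw [injective_iff_map_eq_zero]
  intro q hq
  obtain ⟨s, hs⟩ := (IsLocalizedModule.eq_zero_iff S _).1 hq
  rcases smul_eq_zero.1 hs with h0 | h0
  · exact absurd (h0 ▸ s.2) h.hS0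
  · exact h0

theorem main_pd (h : PB R A V K S) (n : ℕ) : ∀ (Q : Type) [AddCommGroup Q] [Module R Q]
    [Module.IsTorsionFree R Q], PDL A (A ⊗[R] Q) (n + 1) → PDL V (V ⊗[R] Q) (n + 1) →
    PDL R Q (n + 1) := by
  have := h.dom
  induction n with
  | zero =>
    intro Q _ _ _ h1 h2
    rw [zero_add, PDL_one_iff] at h1 h2 ⊢
    obtain ⟨α, hα⟩ := h.hα
    obtain ⟨σ, hσ⟩ := Module.projective_lifting_property ((fcov R Q).baseChange A) LinearMap.id
      (LinearMap.lTensor_surjective A (fcov_surj R Q))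
    obtain ⟨s, hs⟩ := milnor α hα h.hA h.hVK h.hJ h.hRV (fcov R Q) (fcov_surj R Q)
      (σ.restrictScalars R) (fun x => LinearMap.congr_fun hσ x) h2 (h.V_mk_inj Q)
    exact Module.Projective.of_split s _ hs
  | succ n ih =>
    intro Q _ _ _ h1 h2
    rw [PDL_ker (fcov R Q) (fcov_surj R Q)]
    apply ih
    · exact (h.A_ker_iff _ (fcov_surj R Q) (jgood_tf A Q) n).1 h1
    · exact (h.V_ker_iff _ (fcov_surj R Q) n).1 h2

lemma tf_pdl (h : PB R A V K S) (Q : Type) [AddCommGroup Q] [Module R Q]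
    [Module.IsTorsionFree R Q] : PDL R Q 3 :=
  h.main_pd 2 Q (h.glA _) (PDL_mono (by omega) (h.glV _))

lemma gld (h : PB R A V K S) : GLD R 4 := by
  intro N _ _
  have := h.dom
  rw [PDL_ker (fcov R N) (fcov_surj R N)]
  exact h.tf_pdl _

lemma stor_pdl (h : PB R A V K S) (C : Type) [AddCommGroup C] [Module R C]
    (hC : ∀ q : C, ∃ s ∈ S, s • q = 0) : PDL R C 3 := by
  have := h.dom
  rw [PDL_ker (fcov R C) (fcov_surj R C)]
  exact h.main_pd 1 _ ((h.A_ker_iff _ (fcov_surj R C) (h.jgood_tors hC) 1).1 (h.glA _)) (h.glV _)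

end PB
end Setup

section WDim
open TensorProduct

section
variable {R : Type} [CommRing R] {M₁ M₂ M₃ : Type} [AddCommGroup M₁] [Module R M₁]
  [AddCommGroup M₂] [Module R M₂] [AddCommGroup M₃] [Module R M₃]

lemma flat_X1 (f : M₁ →ₗ[R] M₂) (g : M₂ →ₗ[R] M₃) (hf : Function.Injective f)
    (hfg : Function.Exact f g) (hg : Function.Surjective g)
    [Module.Flat R M₂] [Module.Flat R M₃] : Module.Flat R M₁ := by
  rw [Module.Flat.iff_rTensor_preserves_injective_linearMap]
  intro N N' _ _ _ _ φ hφ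
  have h1 : Function.Injective ((LinearMap.lTensor N' f).comp (LinearMap.rTensor M₁ φ)) := by
    rw [LinearMap.lTensor_comp_rTensor, ← LinearMap.rTensor_comp_lTensor, LinearMap.coe_comp]
    exact (Module.Flat.rTensor_preserves_injective_linearMap φ hφ).comp
      (LinearMap.lTensor_injective_of_exact_of_flat g hg f hf hfg N)
  rw [LinearMap.coe_comp] at h1
  exact h1.of_comp

lemma flat_X2 (f : M₁ →ₗ[R] M₂) (g : M₂ →ₗ[R] M₃) (hf : Function.Injective f)
    (hfg : Function.Exact f g) (hg : Function.Surjective g)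
    [Module.Flat R M₁] [Module.Flat R M₃] : Module.Flat R M₂ := by
  rw [Module.Flat.iff_rTensor_preserves_injective_linearMap]
  intro N N' _ _ _ _ φ hφ
  rw [injective_iff_map_eq_zero]
  intro x hx
  have e1 : ∀ x, LinearMap.lTensor N' g (LinearMap.rTensor M₂ φ x) =
      LinearMap.rTensor M₃ φ (LinearMap.lTensor N g x) := by
    intro x
    rw [← LinearMap.comp_apply, ← LinearMap.comp_apply, LinearMap.lTensor_comp_rTensor,
        LinearMap.rTensor_comp_lTensor]
  have e2 : ∀ x, LinearMap.lTensor N' f (LinearMap.rTensor M₁ φ x) =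
      LinearMap.rTensor M₂ φ (LinearMap.lTensor N f x) := by
    intro x
    rw [← LinearMap.comp_apply, ← LinearMap.comp_apply, LinearMap.lTensor_comp_rTensor,
        LinearMap.rTensor_comp_lTensor]
  have h1 : LinearMap.lTensor N g x = 0 := by
    apply Module.Flat.rTensor_preserves_injective_linearMap (M := M₃) φ hφ
    rw [← e1, hx, map_zero, map_zero]
  obtain ⟨y, rfl⟩ := (lTensor_exact N hfg hg x).1 h1
  rw [← e2] at hx
  have h2 := (map_eq_zero_iff _
    (LinearMap.lTensor_injective_of_exact_of_flat g hg f hf hfg N')).1 hx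
  have h3 := (map_eq_zero_iff _
    (Module.Flat.rTensor_preserves_injective_linearMap (M := M₁) φ hφ)).1 h2
  rw [h3, map_zero]

lemma TV_succ_ker (M : Type) [AddCommGroup M] [Module R M] (g : M₂ →ₗ[R] M₃)
    (hg : Function.Surjective g) [Module.Projective R M₂] (n : ℕ) :
    TV R M M₃ (n + 2) ↔ TV R M (LinearMap.ker g) (n + 1) := by
  have h := LinearMap.exact_subtype_ker_map g
  exact TV_succ M (LinearMap.ker g).subtype g (Submodule.subtype_injective _) h hg n

lemma TV_one_ker (M : Type) [AddCommGroup M] [Module R M] (g : M₂ →ₗ[R] M₃)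
    (hg : Function.Surjective g) [Module.Projective R M₂] :
    TV R M M₃ 1 ↔ Function.Injective (LinearMap.lTensor M (LinearMap.ker g).subtype) := by
  have h := LinearMap.exact_subtype_ker_map g
  exact TV_one M (LinearMap.ker g).subtype g (Submodule.subtype_injective _) h hg

lemma TV_flat (M : Type) [AddCommGroup M] [Module R M] [Module.Flat R M₁] : TV R M M₁ 1 := by
  rw [TV_one_ker M (fcov R M₁) (fcov_surj R M₁)]
  exact LinearMap.lTensor_injective_of_exact_of_flat _ (fcov_surj R M₁) _
    (Submodule.subtype_injective _) (LinearMap.exact_subtype_ker_map _) M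
end

namespace PB
variable {R A V K : Type} [CommRing R] [CommRing A] [CommRing V] [CommRing K]
    [Algebra R A] [Algebra R V] [Algebra R K] [Algebra V K] [IsScalarTower R V K]
    {S : Submonoid R}

lemma V_flat (h : PB R A V K S) (Q : Type) [AddCommGroup Q] [Module R Q]
    [Module.IsTorsionFree R Q] : Module.Flat R (V ⊗[R] Q) := by
  have := h.dom
  have := h.ded
  have := h.loc
  have hl := h.locMod Q
  have : Module.Flat R V := IsLocalization.flat V S
  have : Module.IsTorsionFree V (V ⊗[R] Q) := by
    apply Module.IsTorsionFree.of_smul_eq_zero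
    intro v w hvw
    obtain ⟨⟨r, s⟩, hr⟩ := IsLocalization.surj S v
    obtain ⟨⟨q, t⟩, hq⟩ := IsLocalizedModule.surj S (TensorProduct.mk R V Q 1) w
    simp only at hr hq
    have h1 : TensorProduct.mk R V Q 1 (r • q) = 0 := by
      rw [map_smul, ← hq, ← algebraMap_smul V r, ← hr, mul_comm, mul_smul, smul_comm v, hvw]
      simp
    have h2 : r • q = 0 := by
      apply h.V_mk_inj Q
      rw [h1, map_zero]
    rcases smul_eq_zero.1 h2 with rfl | rfl
    · left
      rw [map_zero] at hr
      exact (IsLocalization.map_units V s).mul_left_eq_zero.1 hr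
    · right
      rw [map_zero] at hq
      have : IsUnit (algebraMap R V t) := IsLocalization.map_units V t
      rw [Submonoid.smul_def, ← algebraMap_smul V] at hq
      exact (this.smul_eq_zero).1 hq
  have : Module.Flat V (V ⊗[R] Q) := inferInstance
  exact Module.Flat.trans R V _

theorem TV_two (h : PB R A V K S) (M Q W : Type) [AddCommGroup M] [Module R M]
    [AddCommGroup Q] [Module R Q] [AddCommGroup W] [Module R W] [Module.Flat R W]
    (j : Q →ₗ[R] W) (hjQ : Function.Injective j)
    (hs : ∀ w : W, ∃ s ∈ S, ∃ q, s • w = j q) : TV R M Q 2 := by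
  let g : (W →₀ R) →ₗ[R] W := fcov R W
  have hg : Function.Surjective g := fcov_surj R W
  have hx := LinearMap.exact_subtype_ker_map g
  have hL := flat_X1 (M₁ := LinearMap.ker g) (LinearMap.ker g).subtype g (Submodule.subtype_injective _) hx hg
  let Qt : Submodule R (W →₀ R) := (LinearMap.range (j)).comap g
  have hC : PDL R ((W →₀ R) ⧸ Qt) 3 := by
    apply h.stor_pdl
    intro x
    obtain ⟨p, rfl⟩ := Submodule.mkQ_surjective _ x
    obtain ⟨t, ht, q, hq⟩ := hs (g p)
    refine ⟨t, ht, ?_⟩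
    rw [← map_smul, Submodule.mkQ_apply, Submodule.Quotient.mk_eq_zero]
    refine ⟨q, ?_⟩
    rw [map_smul]
    exact hq.symm
  have hQt : PDL R Qt 2 := (PDL_X3_iff Qt.subtype Qt.mkQ (Submodule.subtype_injective _)
    (LinearMap.exact_subtype_mkQ _) (Submodule.mkQ_surjective _) 1).1 hC
  have hP1 : Module.Projective R (LinearMap.ker (fcov R Qt)) :=
    PDL_one_iff.1 ((PDL_ker (fcov R Qt) (fcov_surj R Qt) 0).1 hQt)
  let jQ := LinearEquiv.ofInjective (j) hjQ
  let g' : Qt →ₗ[R] LinearMap.range (j) :=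
    g.restrict (fun x hx => hx)
  have hg' : Function.Surjective g' := by
    rintro ⟨w, hw⟩
    obtain ⟨p, rfl⟩ := hg w
    exact ⟨⟨p, hw⟩, rfl⟩
  let k : (Qt →₀ R) →ₗ[R] Q := jQ.symm.toLinearMap.comp (g'.comp (fcov R Qt))
  have hk : Function.Surjective k := jQ.symm.surjective.comp (hg'.comp (fcov_surj R Qt))
  rw [TV_succ_ker M k hk 0]
  have hk0 : ∀ x, k x = 0 ↔ g (fcov R Qt x) = 0 := by
    intro x
    simp only [k, LinearMap.comp_apply]
    rw [LinearEquiv.coe_coe, LinearEquiv.map_eq_zero_iff]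
    exact Subtype.ext_iff
  have hle : LinearMap.ker (fcov R Qt) ≤ LinearMap.ker k := by
    intro x hx
    rw [LinearMap.mem_ker] at hx
    rw [LinearMap.mem_ker, hk0, hx]
    simp
  let l : LinearMap.ker k →ₗ[R] LinearMap.ker g :=
    LinearMap.codRestrict _ (Qt.subtype.comp ((fcov R Qt).comp (LinearMap.ker k).subtype))
      (fun x => (hk0 x.1).1 x.2)
  have hex : Function.Exact (Submodule.inclusion hle) l := by
    · intro x
      constructor
      · intro hx
        have : (Qt.subtype (fcov R Qt x.1)) = 0 := congrArg Subtype.val hx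
        have h2 : fcov R Qt x.1 = 0 := Subtype.ext this
        exact ⟨⟨x.1, h2⟩, rfl⟩
      · rintro ⟨y, rfl⟩
        apply Subtype.ext
        have := y.2
        rw [LinearMap.mem_ker] at this
        change Qt.subtype (fcov R Qt y.1) = 0
        rw [this]
        simp
  have hsl : Function.Surjective l := by
    · rintro ⟨p, hp⟩
      have hp' : p ∈ Qt := by
        change g p ∈ LinearMap.range j
        rw [hp]
        exact Submodule.zero_mem _
      obtain ⟨x, hx⟩ := fcov_surj R Qt ⟨p, hp'⟩
      refine ⟨⟨x, (hk0 x).2 ?_⟩, ?_⟩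
      · rw [hx]; exact hp
      · apply Subtype.ext
        change Qt.subtype (fcov R Qt x) = p
        rw [hx]
        rfl
  have hKk := flat_X2 (M₁ := LinearMap.ker (fcov R Qt)) (M₂ := LinearMap.ker k)
    (M₃ := LinearMap.ker g) (Submodule.inclusion hle) l (Submodule.inclusion_injective hle) hex hsl
  exact TV_flat M

theorem TV_two_tf (h : PB R A V K S) (M Q : Type) [AddCommGroup M] [Module R M]
    [AddCommGroup Q] [Module R Q] [Module.IsTorsionFree R Q] : TV R M Q 2 := by
  have hl := h.locMod Q
  have hfl := h.V_flat Q
  have hs : ∀ w : V ⊗[R] Q, ∃ s ∈ S, ∃ q, s • w = TensorProduct.mk R V Q 1 q := by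
    intro w
    obtain ⟨⟨q, t⟩, hq⟩ := IsLocalizedModule.surj S (TensorProduct.mk R V Q 1) w
    exact ⟨t, t.2, q, hq⟩
  have hi := h.V_mk_inj Q
  have := h.TV_two M Q (V ⊗[R] Q) (TensorProduct.mk R V Q 1) hi hs
  exact this

theorem TV_three (h : PB R A V K S) (M N : Type) [AddCommGroup M] [Module R M]
    [AddCommGroup N] [Module R N] : TV R M N 3 := by
  have := h.dom
  rw [TV_succ_ker M (fcov R N) (fcov_surj R N) 1]
  exact h.TV_two_tf M _

end PB
end WDim

section WLower
open TensorProduct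

theorem not_TV_two {R : Type} [CommRing R] [IsDomain R] (x y : R) (hy : y ≠ 0)
    (hxy : ∀ a, y ∣ a * x → y ∣ a) (h1 : (1 : R) ∉ Ideal.span {x, y}) :
    ¬ TV R (R ⧸ (Ideal.span {x, y} : Ideal R)) (R ⧸ (Ideal.span {x, y} : Ideal R)) 2 := by
  generalize hI : (Ideal.span {x, y} : Ideal R) = I at h1
  have hx : x ∈ I := hI ▸ Ideal.subset_span (by simp)
  have hyI : y ∈ I := hI ▸ Ideal.subset_span (by simp)
  intro h
  have e : Function.Exact I.subtype (Submodule.mkQ I) := LinearMap.exact_subtype_mkQ _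
  have h2 := (TV_succ (M₁ := I) (M₂ := R) (M₃ := R ⧸ I) (R ⧸ I) I.subtype (Submodule.mkQ I)
    (Submodule.subtype_injective _) e (Submodule.mkQ_surjective _) 0).1 h
  let g : (R × R) →ₗ[R] I := LinearMap.coprod (LinearMap.toSpanSingleton R I ⟨x, hx⟩)
    (LinearMap.toSpanSingleton R I ⟨y, hyI⟩)
  have hg0 : ∀ a b, (g (a, b) : R) = a * x + b * y := fun a b => by simp [g]
  let f : R →ₗ[R] (R × R) := LinearMap.toSpanSingleton R (R × R) (-y, x)
  have hf0 : ∀ c, f c = (c * -y, c * x) := fun c => by simp [f]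
  have hf : Function.Injective f := by
    rw [injective_iff_map_eq_zero]
    intro c hc
    rw [hf0, Prod.mk_eq_zero] at hc
    rcases mul_eq_zero.1 hc.1 with h | h
    · exact h
    · exact absurd (neg_eq_zero.1 h) hy
  have hfg : Function.Exact f g := by
    rintro ⟨a, b⟩
    constructor
    · intro h
      have h3 : a * x + b * y = 0 := by rw [← hg0, h]; rfl
      obtain ⟨c, rfl⟩ := hxy a ⟨-b, by linear_combination h3⟩
      refine ⟨-c, ?_⟩
      rw [hf0]
      ext
      · simp; ring
      · simp only
        apply mul_left_cancel₀ hy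
        linear_combination -h3
    · rintro ⟨c, hc⟩
      rw [← hc, hf0]
      apply Subtype.ext
      rw [hg0]
      simp; ring
  have hg : Function.Surjective g := by
    rintro ⟨z, hz⟩
    have hz' := hz
    rw [← hI, Ideal.mem_span_pair] at hz'
    obtain ⟨a, b, rfl⟩ := hz'
    exact ⟨(a, b), Subtype.ext (hg0 a b)⟩
  rw [TV_one (M₁ := R) (M₂ := R × R) (M₃ := I) (R ⧸ I) f g hf hfg hg] at h2
  have hz : ∀ (z : R) (hz : z ∈ I) (m : R ⧸ I), z • m = 0 := by
    intro z hz m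
    obtain ⟨r, rfl⟩ := Submodule.mkQ_surjective _ m
    rw [← map_smul, Submodule.mkQ_apply, Submodule.Quotient.mk_eq_zero]
    exact I.mul_mem_right r hz
  have h5 : ((Submodule.mkQ I (1 : R)) ⊗ₜ[R] (1 : R) : (R ⧸ I) ⊗[R] R) = 0 := by
    apply h2
    rw [LinearMap.lTensor_tmul, map_zero, hf0]
    have : ((1 : R) * -y, (1 : R) * x) = y • ((-1 : R), (0 : R)) + x • ((0 : R), (1 : R)) := by
      simp
    rw [this, tmul_add, ← smul_tmul, ← smul_tmul, hz y hyI, hz x hx]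
    simp
  have h6 := congrArg (TensorProduct.rid R _) h5
  rw [rid_tmul, one_smul, map_zero, Submodule.mkQ_apply, Submodule.Quotient.mk_eq_zero] at h6
  exact h1 h6

end WLower

section PLower
set_option linter.unusedSectionVars false
open Polynomial

section
variable {R V ι : Type} [CommRing R] [IsDomain R] [CommRing V] [Algebra R V]
  (y : R) (x : ι → R) (t : V) (e : ι → V)

/-- the evaluation map onto the module `F` -/
noncomputable def mF : (R[X] × (ι →₀ R[X])) →ₗ[R] V :=
  LinearMap.coprod (aeval t).toLinearMap
    (Finsupp.lsum R fun a => (LinearMap.mulLeft R (e a)).comp (aeval t).toLinearMap)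

/-- the relations -/
noncomputable def phiF : (ι →₀ R[X]) →ₗ[R[X]] (R[X] × (ι →₀ R[X])) :=
  LinearMap.prod (-(Finsupp.lsum R[X] fun _ => LinearMap.id))
    (Finsupp.mapRange.linearMap (M := R[X]) LinearMap.id |>.comp
      (Finsupp.lsum R[X] fun a => (C (x a)) • Finsupp.lsingle a))

lemma phiF_fst (h : ι →₀ R[X]) : (phiF x h).1 = -(h.sum fun _ p => p) := by
  simp [phiF]
  rfl

lemma phiF_snd (h : ι →₀ R[X]) (a : ι) : (phiF x h).2 a = C (x a) * h a := by
  classical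
  simp only [phiF, LinearMap.prod_apply, Function.prod, LinearMap.comp_apply]
  rw [Finsupp.mapRange.linearMap_id, LinearMap.id_apply, Finsupp.lsum_apply, Finsupp.sum,
    Finsupp.finsetSum_apply]
  simp only [LinearMap.smul_apply, Finsupp.lsingle_apply, Finsupp.smul_apply, smul_eq_mul,
    Finsupp.single_apply, mul_ite, mul_zero]
  rw [Finset.sum_ite_eq']
  split_ifs with h1
  · rfl
  · rw [Finsupp.notMem_support_iff.1 h1, mul_zero]

lemma phiF_single (a : ι) (p : R[X]) :
    phiF x (Finsupp.single a p) = (-p, Finsupp.single a (C (x a) * p)) := by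
  classical
  ext1
  · rw [phiF_fst, Finsupp.sum_single_index rfl]
  · ext1 b
    rw [phiF_snd, Finsupp.single_apply, Finsupp.single_apply]
    split_ifs with h
    · rw [h]
    · rw [mul_zero]

/-- `1 - y T` -/
noncomputable def thetaF : R[X] := 1 - C y * X

/-- the presentation -/
noncomputable def deltaF : ((R[X] × (ι →₀ R[X])) × (ι →₀ R[X])) →ₗ[R[X]] (R[X] × (ι →₀ R[X])) :=
  LinearMap.coprod (LinearMap.lsmul R[X] _ (thetaF y)) (phiF x)

lemma deltaF_apply (p : R[X] × (ι →₀ R[X])) (h : ι →₀ R[X]) :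
    deltaF y x (p, h) = thetaF y • p + phiF x h := by
  simp [deltaF]

/-- second syzygy -/
noncomputable def iF : (ι →₀ R[X]) →ₗ[R[X]] ((R[X] × (ι →₀ R[X])) × (ι →₀ R[X])) :=
  LinearMap.prod (phiF x) (-(LinearMap.lsmul R[X] _ (thetaF y)))

lemma iF_apply (h : ι →₀ R[X]) : iF y x h = (phiF x h, -(thetaF y • h)) := by
  simp [iF]

lemma deltaF_iF (h : ι →₀ R[X]) : deltaF y x (iF y x h) = 0 := by
  rw [iF_apply, deltaF_apply, map_neg, map_smul, add_neg_cancel]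

lemma thetaF_ne : thetaF y ≠ 0 := by
  intro h
  have := congrArg (fun p => coeff p 0) h
  simp [thetaF] at this

lemma iF_inj : Function.Injective (iF y x) := by
  rw [injective_iff_map_eq_zero]
  intro h hh
  rw [iF_apply, Prod.mk_eq_zero, neg_eq_zero] at hh
  exact (smul_eq_zero.1 hh.2).resolve_left (thetaF_ne y)

lemma theta_cancel (p q : R[X] × (ι →₀ R[X])) (h : thetaF y • p = thetaF y • q) : p = q := by
  refine Prod.ext ?_ (Finsupp.ext fun a => ?_)
  · exact mul_left_cancel₀ (thetaF_ne y) (congrArg Prod.fst h)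
  · exact mul_left_cancel₀ (thetaF_ne y) (congrArg (fun z => z.2 a) h)

lemma iF_exact (hx : ∀ a, Prime (x a)) : Function.Exact (iF y x) (deltaF y x) := by
  rintro ⟨p, h⟩
  constructor
  · intro h0
    rw [deltaF_apply] at h0
    have hd : ∀ a, ∃ q, h a = -(thetaF y * q) := by
      intro a
      have h1 : thetaF y * p.2 a + C (x a) * h a = 0 := by
        have := congrArg (fun z => z.2 a) h0
        simpa [phiF_snd] using this
      have hp : Prime (C (x a)) := prime_C_iff.2 (hx a)
      have hdvd : C (x a) ∣ thetaF y * p.2 a := ⟨-h a, by linear_combination h1⟩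
      rcases hp.dvd_or_dvd hdvd with h2 | ⟨q, hq⟩
      · exfalso
        rw [C_dvd_iff_dvd_coeff] at h2
        have := h2 0
        simp [thetaF] at this
        exact (hx a).not_isUnit (isUnit_of_dvd_one this)
      · refine ⟨q, mul_left_cancel₀ hp.ne_zero ?_⟩
        rw [hq] at h1
        linear_combination h1
    choose q hq using hd
    have hq0 : ∀ a, h a = 0 → q a = 0 := by
      intro a ha
      have := hq a
      rw [ha, eq_comm, neg_eq_zero] at this
      exact (mul_eq_zero.1 this).resolve_left (thetaF_ne y)
    let h' : ι →₀ R[X] := Finsupp.onFinset h.support q (by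
      intro a ha
      rw [Finsupp.mem_support_iff]
      exact fun h2 => ha (hq0 a h2))
    have hh : h = -(thetaF y • h') := by
      ext1 a
      rw [hq a]
      simp [h']
    refine ⟨h', ?_⟩
    rw [iF_apply, ← hh]
    congr 1
    rw [hh, map_neg, map_smul, ← sub_eq_add_neg] at h0
    exact (theta_cancel y _ _ (sub_eq_zero.1 h0)).symm
  · rintro ⟨h', hh⟩
    rw [← hh, deltaF_iF]

lemma mF_apply (g : R[X] × (ι →₀ R[X])) :
    mF t e g = aeval t g.1 + g.2.sum fun a p => e a * aeval t p := by
  simp [mF]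
  rfl

lemma mF_smul (q : R[X]) (g : R[X] × (ι →₀ R[X])) :
    mF t e (q • g) = aeval t q * mF t e g := by
  classical
  rw [mF_apply, mF_apply, mul_add, Prod.smul_fst, Prod.smul_snd, smul_eq_mul, map_mul,
    Finsupp.sum_of_support_subset _ Finsupp.support_smul _ (by simp), Finsupp.sum, Finset.mul_sum]
  congr 1
  apply Finset.sum_congr rfl
  intro a _
  rw [Finsupp.smul_apply, smul_eq_mul, map_mul]
  ring

lemma mF_phi (he : ∀ a, algebraMap R V (x a) * e a = 1) (h : ι →₀ R[X]) :
    mF t e (phiF x h) = 0 := by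
  classical
  induction h using Finsupp.induction_linear with
  | zero => simp
  | add f g hf hg => rw [map_add, map_add, hf, hg, add_zero]
  | single a p =>
    rw [phiF_single, mF_apply, Finsupp.sum_single_index (by simp), map_mul, aeval_C, map_neg]
    linear_combination (aeval t p) * he a

lemma mF_delta (ht : algebraMap R V y * t = 1) (he : ∀ a, algebraMap R V (x a) * e a = 1) (z) :
    mF t e (deltaF y x z) = 0 := by
  rw [← Prod.mk.eta (p := z), deltaF_apply, map_add, mF_phi x t e he, mF_smul]
  have : aeval t (thetaF y) = 0 := by simp [thetaF, ht]
  rw [this, zero_mul, zero_add]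

/-- reduce a polynomial modulo `1 - y T` -/
lemma reduceF (p : R[X]) (n : ℕ) (hn : p.natDegree ≤ n) : ∃ (c : R) (q : R[X]),
    p = thetaF y * q + C c * X ^ n := by
  have hm : ∀ i ≤ n, thetaF y ∣ X ^ i - C (y ^ (n - i)) * X ^ n := by
    intro i hi
    have h1 : X ^ i - C (y ^ (n - i)) * X ^ n = X ^ i * (1 - (C y * X) ^ (n - i)) := by
      obtain ⟨k, rfl⟩ := Nat.exists_eq_add_of_le hi
      rw [Nat.add_sub_cancel_left, C_pow, pow_add, mul_pow]
      ring
    rw [h1]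
    have h2 : thetaF y ∣ 1 ^ (n - i) - (C y * X) ^ (n - i) := sub_dvd_pow_sub_pow _ _ _
    rw [one_pow] at h2
    exact h2.mul_left _
  refine ⟨∑ i ∈ Finset.range (n + 1), p.coeff i * y ^ (n - i), ?_⟩
  have h3 : thetaF y ∣ p - C (∑ i ∈ Finset.range (n + 1), p.coeff i * y ^ (n - i)) * X ^ n := by
    conv_rhs => arg 1; rw [p.as_sum_range_C_mul_X_pow' (Nat.lt_succ_of_le hn)]
    rw [map_sum, Finset.sum_mul, ← Finset.sum_sub_distrib]
    apply Finset.dvd_sum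
    intro i hi
    rw [Finset.mem_range] at hi
    have := (hm i (by omega)).mul_left (C (p.coeff i))
    rw [mul_sub] at this
    rw [C_mul, mul_assoc]
    exact this
  obtain ⟨q, hq⟩ := h3
  exact ⟨q, by rw [← hq]; ring⟩

lemma mF_ker (hRV : Function.Injective (algebraMap R V)) (hx : ∀ a, Prime (x a))
    (hxx : ∀ a b, a ≠ b → ¬ x b ∣ x a)
    (ht : algebraMap R V y * t = 1) (he : ∀ a, algebraMap R V (x a) * e a = 1)
    (g : R[X] × (ι →₀ R[X])) (hg : mF t e g = 0) : ∃ z, deltaF y x z = g := by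
  classical
  obtain ⟨g, h⟩ := g
  let n : ℕ := max g.natDegree (h.support.sup fun a => (h a).natDegree)
  obtain ⟨c, q, hcq⟩ := reduceF y g n (le_max_left _ _)
  have H : ∀ a, ∃ (c : R) (q : R[X]), h a = thetaF y * q + C c * X ^ n ∧
      (h a = 0 → c = 0 ∧ q = 0) := by
    intro a
    by_cases h0 : h a = 0
    · exact ⟨0, 0, by simp [h0], fun _ => ⟨rfl, rfl⟩⟩
    · obtain ⟨c, q, hcq⟩ := reduceF y (h a) n (le_trans
        (Finset.le_sup (f := fun a => (h a).natDegree) (Finsupp.mem_support_iff.2 h0))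
        (le_max_right _ _))
      exact ⟨c, q, hcq, fun h1 => absurd h1 h0⟩
  choose cc qq hcc h00 using H
  -- values in V
  have hth : aeval t (thetaF y) = 0 := by simp [thetaF, ht]
  have hv : algebraMap R V c + ∑ a ∈ h.support, algebraMap R V (cc a) * e a = 0 := by
    rw [mF_apply] at hg
    have h1 : aeval t g = algebraMap R V c * t ^ n := by
      rw [hcq, map_add, map_mul, hth]; simp
    have h2 : ∀ a, aeval t (h a) = algebraMap R V (cc a) * t ^ n := by
      intro a
      rw [hcc a, map_add, map_mul, hth]; simp
    simp only [Finsupp.sum, h1, h2] at hg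
    have h3 : (algebraMap R V c + ∑ a ∈ h.support, algebraMap R V (cc a) * e a) * t ^ n = 0 := by
      rw [← hg, add_mul, Finset.sum_mul]
      congr 1
      exact Finset.sum_congr rfl fun a _ => by ring
    have h4 : t ^ n * algebraMap R V y ^ n = 1 := by rw [← mul_pow, mul_comm t, ht, one_pow]
    calc _ = (algebraMap R V c + ∑ a ∈ h.support, algebraMap R V (cc a) * e a) *
          (t ^ n * algebraMap R V y ^ n) := by rw [h4, mul_one]
      _ = 0 := by rw [← mul_assoc, h3, zero_mul]
  have hdv : ∀ b, ∃ k, cc b = x b * k := by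
    intro b
    by_cases hb : b ∈ h.support
    swap
    · exact ⟨0, by rw [(h00 b (Finsupp.notMem_support_iff.1 hb)).1, mul_zero]⟩
    have h1 : c * ∏ a ∈ h.support, x a
        + ∑ a ∈ h.support, cc a * ∏ a' ∈ h.support.erase a, x a' = 0 := by
      apply hRV
      rw [map_zero, ← zero_mul (algebraMap R V (∏ a ∈ h.support, x a)), ← hv, map_add, map_mul,
        map_sum, add_mul, Finset.sum_mul]
      congr 1
      refine Finset.sum_congr rfl fun a ha => ?_
      rw [← Finset.mul_prod_erase _ _ ha, map_mul, map_mul]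
      linear_combination (-algebraMap R V (cc a) *
        algebraMap R V (∏ a' ∈ h.support.erase a, x a')) * he a
    have h2 : x b ∣ cc b * ∏ a' ∈ h.support.erase b, x a' := by
      rw [← Finset.add_sum_erase _ _ hb] at h1
      have h3 : x b ∣ c * ∏ a ∈ h.support, x a := (Finset.dvd_prod_of_mem _ hb).mul_left _
      have h4 : x b ∣ ∑ a ∈ h.support.erase b, cc a * ∏ a' ∈ h.support.erase a, x a' := by
        apply Finset.dvd_sum
        intro a ha
        refine (Finset.dvd_prod_of_mem _ ?_).mul_left _
        exact Finset.mem_erase.2 ⟨(Finset.ne_of_mem_erase ha).symm, hb⟩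
      have h5 : cc b * ∏ a' ∈ h.support.erase b, x a' = -(c * ∏ a ∈ h.support, x a
          + ∑ a ∈ h.support.erase b, cc a * ∏ a' ∈ h.support.erase a, x a') := by
        linear_combination h1
      rw [h5]
      exact (dvd_add h3 h4).neg_right
    rcases (hx b).dvd_or_dvd h2 with h3 | h3
    · exact h3
    · obtain ⟨a, ha, h4⟩ := (hx b).exists_mem_finset_dvd h3
      exact absurd h4 (hxx a b (Finset.ne_of_mem_erase ha))
  choose k hk using hdv
  have hk0 : ∀ a, h a = 0 → k a = 0 := by
    intro a ha
    have := hk a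
    rw [(h00 a ha).1] at this
    exact (mul_eq_zero.1 this.symm).resolve_left (hx a).ne_zero
  have hck : c + ∑ a ∈ h.support, k a = 0 := by
    apply hRV
    rw [map_zero, ← hv, map_add, map_sum]
    congr 1
    refine Finset.sum_congr rfl fun a _ => ?_
    rw [hk a, map_mul]
    linear_combination (-algebraMap R V (k a)) * he a
  let q' : ι →₀ R[X] := Finsupp.onFinset h.support qq (by
    intro a ha
    rw [Finsupp.mem_support_iff]
    exact fun h2 => ha (h00 a h2).2)
  let k' : ι →₀ R[X] := Finsupp.onFinset h.support (fun a => C (k a) * X ^ n) (by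
    intro a ha
    rw [Finsupp.mem_support_iff]
    exact fun h2 => ha (by rw [hk0 a h2]; simp))
  refine ⟨((q, q'), k'), ?_⟩
  rw [deltaF_apply]
  refine Prod.ext ?_ ?_
  · rw [Prod.fst_add, phiF_fst, Finsupp.onFinset_sum _ (fun _ => rfl)]
    have h1 : c = - ∑ a ∈ h.support, k a := by linear_combination hck
    change thetaF y * q + _ = g
    rw [hcq, h1, map_neg, map_sum, neg_mul, Finset.sum_mul]
  · ext1 a
    rw [Prod.snd_add, Finsupp.add_apply, phiF_snd]
    change thetaF y * qq a + C (x a) * (C (k a) * X ^ n) = h a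
    rw [hcc a, hk a, C_mul, mul_assoc]

end
end PLower

section PLower2
open Polynomial
set_option linter.unusedSectionVars false

lemma lower_star {R V ι : Type} [CommRing R] [IsDomain R] [CommRing V] [Algebra R V]
    (y : R) (x : ι → R) (t : V) (e : ι → V)
    (hRV : Function.Injective (algebraMap R V)) (hx : ∀ a, Prime (x a))
    (hxx : ∀ a b, a ≠ b → ¬ x b ∣ x a)
    (ht : algebraMap R V y * t = 1) (he : ∀ a, algebraMap R V (x a) * e a = 1)
    (hV : PDL R V 2) (hC : PDL R (V ⧸ LinearMap.range (mF t e : _ →ₗ[R] V)) 3)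
    (g : ι → ℕ → R) : ∃ (u : ℕ → R) (v w : ι → ℕ → R),
      ∀ a n, g a n = - u n + x a * v a n - w a n + y * w a (n + 1) := by
  have hF : PDL R (LinearMap.range (mF t e : _ →ₗ[R] V)) 2 :=
    PDL_X1 (M₁ := LinearMap.range (mF t e : _ →ₗ[R] V)) (M₂ := V)
      (M₃ := V ⧸ LinearMap.range (mF t e : _ →ₗ[R] V)) (Submodule.subtype _) (Submodule.mkQ _)
      (Submodule.subtype_injective _) (LinearMap.exact_subtype_mkQ _)
      (Submodule.mkQ_surjective _) 2 hV hC
  let m : (R[X] × (ι →₀ R[X])) →ₗ[R] LinearMap.range (mF t e : _ →ₗ[R] V) :=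
    (mF t e).rangeRestrict
  have hm : Function.Surjective m := LinearMap.surjective_rangeRestrict _
  have hK : PDL R (LinearMap.ker m) 1 := (PDL_ker m hm 0).1 hF
  rw [PDL_one_iff] at hK
  let d : ((R[X] × (ι →₀ R[X])) × (ι →₀ R[X])) →ₗ[R] LinearMap.ker m :=
    LinearMap.codRestrict _ ((deltaF y x).restrictScalars R) (fun z => by
      rw [LinearMap.mem_ker]
      exact Subtype.ext (mF_delta y x t e ht he z))
  have hd : Function.Surjective d := by
    rintro ⟨z, hz⟩
    rw [LinearMap.mem_ker] at hz
    obtain ⟨w, hw⟩ := mF_ker y x t e hRV hx hxx ht he z (congrArg Subtype.val hz)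
    exact ⟨w, Subtype.ext hw⟩
  obtain ⟨s, hs⟩ := Module.projective_lifting_property d LinearMap.id hd
  have hsplit : ∃ r : ((R[X] × (ι →₀ R[X])) × (ι →₀ R[X])) →ₗ[R] (ι →₀ R[X]),
      ∀ h, r (iF y x h) = h := by
    have hex : ∀ z, ∃ h, iF y x h = z - s (d z) := by
      intro z
      refine (iF_exact y x hx _).1 ?_
      rw [map_sub, sub_eq_zero]
      have := congrArg Subtype.val (LinearMap.congr_fun hs (d z))
      exact this.symm
    choose r hr using hex
    refine ⟨{ toFun := r, map_add' := ?_, map_smul' := ?_ }, ?_⟩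
    · intro z z'
      apply iF_inj y x
      rw [map_add, hr, hr, hr, map_add, map_add]
      abel
    · intro c z
      apply iF_inj y x
      have h1 : iF y x (c • r z) = c • iF y x (r z) := ((iF y x).restrictScalars R).map_smul c _
      rw [RingHom.id_apply, h1, hr, hr, map_smul, map_smul, smul_sub]
    · intro h
      apply iF_inj y x
      change iF y x (r _) = _
      rw [hr]
      have : d (iF y x h) = 0 := Subtype.ext (deltaF_iF y x h)
      rw [this, map_zero, sub_zero]
  obtain ⟨r, hr⟩ := hsplit
  let l : (ι →₀ R[X]) →ₗ[R] R := Finsupp.lsum R fun a =>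
    Polynomial.lsum fun n => LinearMap.mulRight R (g a n)
  have hl : ∀ a n, l (Finsupp.single a (X ^ n)) = g a n := by
    intro a n
    simp only [l]
    rw [Finsupp.lsum_single, Polynomial.lsum_apply, ← monomial_one_right_eq_X_pow,
      sum_monomial_index]
    · simp
    · simp
  let L := l.comp r
  refine ⟨fun n => L ((X ^ n, 0), 0), fun a n => L ((0, Finsupp.single a (X ^ n)), 0),
    fun a n => L ((0, 0), Finsupp.single a (X ^ n)), fun a n => ?_⟩
  have h1 : L (iF y x (Finsupp.single a (X ^ n))) = g a n := by
    rw [← hl a n]; exact congrArg l (hr _)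
  rw [← h1, iF_apply, phiF_single]
  have h2 : (((-X ^ n, Finsupp.single a (C (x a) * X ^ n)),
      -(thetaF y • Finsupp.single a (X ^ n))) : (R[X] × (ι →₀ R[X])) × (ι →₀ R[X])) =
      - ((X ^ n, 0), 0) + x a • ((0, Finsupp.single a (X ^ n)), 0)
        - ((0, 0), Finsupp.single a (X ^ n)) + y • ((0, 0), Finsupp.single a (X ^ (n + 1))) := by
    have e1 : C (x a) * X ^ n = x a • (X ^ n : R[X]) := by rw [smul_eq_C_mul]
    have e2 : thetaF y * X ^ n = X ^ n - y • (X ^ (n + 1) : R[X]) := by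
      rw [smul_eq_C_mul, thetaF]; ring
    rw [Finsupp.smul_single, smul_eq_mul, e1, e2]
    simp [Finsupp.single_sub]
    abel
  rw [h2, map_add, map_sub, map_add, map_neg, map_smul, map_smul, smul_eq_mul, smul_eq_mul]

/-- no bounded solution -/
lemma no_series (w : ℕ → ℂ[X]) (h : ∀ n, 1 = - w n + X * w (n + 1)) : False := by
  have h0 : ∀ n, w n ≠ 0 := by
    intro n hn
    have := congrArg (fun p => coeff p 0) (h n)
    rw [hn] at this
    simp at this
  have hw : ∀ n, (w n).natDegree = (w (n + 1)).natDegree + 1 := by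
    intro n
    have h1 : w n + 1 = X * w (n + 1) := by linear_combination h n
    have h2 : (w n + 1).natDegree = (w n).natDegree := by
      rw [← C_1, natDegree_add_C]
    rw [← h2, h1, natDegree_X_mul (h0 _)]
  have h2 : ∀ n, (w 0).natDegree = (w n).natDegree + n := by
    intro n
    induction n with
    | zero => rfl
    | succ n ih => rw [ih, hw n]; omega
  have := h2 ((w 0).natDegree + 1)
  omega

lemma exists_enum : ∃ Ψ : ℂ → (ℕ → Axy), Function.Surjective Ψ := by
  have h1 : Cardinal.mk (ℕ → Axy) ≤ Cardinal.mk ℂ := by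
    rw [Cardinal.mk_arrow, Cardinal.lift_id, Cardinal.lift_id, Cardinal.mk_nat]
    have h2 : Cardinal.mk Axy ≤ Cardinal.continuum := by
      refine (Polynomial.cardinalMk_le_max).trans (max_le ?_ Cardinal.aleph0_le_continuum)
      refine (Polynomial.cardinalMk_le_max).trans (max_le ?_ Cardinal.aleph0_le_continuum)
      rw [Cardinal.mk_complex]
    calc _ ≤ Cardinal.continuum ^ Cardinal.aleph0 := Cardinal.power_le_power_right h2
      _ = _ := by rw [Cardinal.continuum_power_aleph0, Cardinal.mk_complex]
  obtain ⟨f⟩ := h1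
  exact ⟨Function.invFun f, Function.invFun_surjective f.injective⟩

lemma lower_main {R V : Type} [CommRing R] [IsDomain R] [CommRing V] [Algebra R V]
    (π : R →+* Axy) (c : Axy →+* R) (hπc : ∀ a, π (c a) = a)
    (t : V) (e : ℂ → V) (hRV : Function.Injective (algebraMap R V))
    (hx : ∀ a : ℂ, Prime (c (C (X - C a))))
    (hxx : ∀ a b : ℂ, a ≠ b → ¬ c (C (X - C b)) ∣ c (C (X - C a)))
    (ht : algebraMap R V (c X) * t = 1)
    (he : ∀ a, algebraMap R V (c (C (X - C a))) * e a = 1)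
    (hC : PDL R (V ⧸ LinearMap.range (mF t e : _ →ₗ[R] V)) 3) : ¬ PDL R V 2 := by
  intro hV
  obtain ⟨Ψ, hΨ⟩ := exists_enum
  obtain ⟨u, v, w, H⟩ := lower_star (c X) (fun a : ℂ => c (C (X - C a))) t e hRV hx hxx ht he hV hC
    (fun a n => 1 - c (Ψ a n))
  obtain ⟨a, ha⟩ := hΨ (fun n => π (u n))
  let ev : Axy →+* ℂ[X] := mapRingHom (evalRingHom a)
  apply no_series (fun n => ev (π (w a n)))
  intro n
  have h1 := congrArg (fun r => ev (π r)) (H a n)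
  simp only [map_sub, map_add, map_neg, map_mul, map_one, hπc, ha] at h1
  have h2 : ev X = X := by simp [ev]
  have h3 : ev (C X) - ev (C (C a)) = 0 := by simp [ev]
  rw [h2, h3] at h1
  linear_combination h1
end PLower2

section PFinal
open Polynomial
set_option linter.unusedSectionVars false

/-- Concrete pullback data. -/
structure DD (R V K : Type) [CommRing R] [CommRing V] [Field K]
    [Algebra R Axy] [Algebra R V] [Algebra R K] [Algebra V K] [IsScalarTower R V K]
    [Algebra Axy K] [IsScalarTower R Axy K] (σ : K →+* V) (c : Axy →+* R) (z : V) : Prop where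
  dom : IsDomain R
  dvr : ∃ _ : IsDomain V, IsDiscreteValuationRing V
  frac : IsFractionRing Axy K
  hσ : ∀ k, algebraMap V K (σ k) = k
  hc : ∀ a, algebraMap R V (c a) = σ (algebraMap Axy K a)
  hRV : Function.Injective (algebraMap R V)
  hmem : ∀ v a, algebraMap V K v = algebraMap Axy K a → ∃ r, algebraMap R V r = v
  hz : ∀ v, algebraMap V K v = 0 ↔ z ∣ v
  hz0 : z ≠ 0
  glV : GLD V 2

namespace DD
variable {R V K : Type} [CommRing R] [CommRing V] [Field K]
    [Algebra R Axy] [Algebra R V] [Algebra R K] [Algebra V K] [IsScalarTower R V K]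
    [Algebra Axy K] [IsScalarTower R Axy K] {σ : K →+* V} {c : Axy →+* R} {z : V}

lemma injA (h : DD R V K σ c z) : Function.Injective (algebraMap Axy K) :=
  have := h.frac
  IsFractionRing.injective Axy K

lemma comm (r : R) : algebraMap V K (algebraMap R V r) = algebraMap Axy K (algebraMap R Axy r) := by
  rw [← IsScalarTower.algebraMap_apply, ← IsScalarTower.algebraMap_apply]

lemma pc (h : DD R V K σ c z) (a : Axy) : algebraMap R Axy (c a) = a := by
  apply h.injA
  rw [← comm (V := V), h.hc, h.hσ]

lemma mul_inv (h : DD R V K σ c z) {a : Axy} (ha : a ≠ 0) :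
    algebraMap R V (c a) * σ (algebraMap Axy K a)⁻¹ = 1 := by
  rw [h.hc, ← map_mul, mul_inv_cancel₀, map_one]
  exact (map_ne_zero_iff _ h.injA).2 ha

lemma hdiv (h : DD R V K σ c z) {a : Axy} (ha : a ≠ 0) (r : R) :
    c a ∣ r ↔ a ∣ algebraMap R Axy r := by
  constructor
  · rintro ⟨s, rfl⟩
    rw [map_mul, h.pc]
    exact dvd_mul_right _ _
  · rintro ⟨b, hb⟩
    have ha' : algebraMap Axy K a ≠ 0 := (map_ne_zero_iff _ h.injA).2 ha
    obtain ⟨s, hs⟩ := h.hmem (algebraMap R V r * σ (algebraMap Axy K a)⁻¹) b (by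
      rw [map_mul, h.hσ, comm, hb, map_mul]
      field_simp)
    refine ⟨s, h.hRV ?_⟩
    rw [map_mul, hs]
    linear_combination (-algebraMap R V r) * h.mul_inv ha

lemma c_prime (h : DD R V K σ c z) {a : Axy} (ha : Prime a) : Prime (c a) := by
  refine ⟨fun h0 => ha.ne_zero ?_, fun hu => ha.not_isUnit ?_, fun r s hrs => ?_⟩
  · rw [← h.pc a, h0, map_zero]
  · rw [← h.pc a]; exact hu.map _
  · rw [h.hdiv ha.ne_zero] at hrs ⊢
    rw [h.hdiv ha.ne_zero]
    rw [map_mul] at hrs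
    exact ha.dvd_or_dvd hrs

/-- the multiplicative set -/
noncomputable def S (c : Axy →+* R) : Submonoid R := Submonoid.map c (nonZeroDivisors Axy)

lemma loc (h : DD R V K σ c z) : IsLocalization (S c) V := by
  have := h.frac
  refine (isLocalization_iff _ _).2 ⟨?_, ?_, ?_⟩
  · rintro ⟨_, a, ha, rfl⟩
    exact IsUnit.of_mul_eq_one _ (h.mul_inv (nonZeroDivisors.ne_zero ha))
  · intro v
    obtain ⟨⟨a, b⟩, hab⟩ := IsLocalization.surj (nonZeroDivisors Axy) (algebraMap V K v)
    obtain ⟨r, hr⟩ := h.hmem (v * algebraMap R V (c b)) a (by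
      rw [map_mul, h.hc, h.hσ, hab])
    exact ⟨(r, ⟨c b, b, b.2, rfl⟩), hr.symm⟩
  · intro r s hrs
    exact ⟨1, by rw [h.hRV hrs]⟩

lemma hS (h : DD R V K σ c z) : ∀ s ∈ S c, ∀ j : R, algebraMap R Axy j = 0 →
    ∃ j', algebraMap R Axy j' = 0 ∧ j = j' * s := by
  rintro _ ⟨a, ha, rfl⟩ j hj
  have ha0 := nonZeroDivisors.ne_zero ha
  obtain ⟨j', hj'⟩ := (h.hdiv ha0 j).2 (by rw [hj]; exact dvd_zero _)
  refine ⟨j', ?_, by rw [hj', mul_comm]⟩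
  rw [hj', map_mul, h.pc] at hj
  exact (mul_eq_zero.1 hj).resolve_left ha0

lemma hdir_aux (h : DD R V K σ c z) (j₁ j₂ : R) (h1 : algebraMap R Axy j₁ = 0)
    (hd : algebraMap R V j₁ ∣ algebraMap R V j₂) :
    ∃ j, algebraMap R Axy j = 0 ∧ j ∣ j₁ ∧ j ∣ j₂ := by
  obtain ⟨v, hv⟩ := hd
  have := h.loc
  obtain ⟨⟨r, s⟩, hrs⟩ := IsLocalization.surj (S c) v
  obtain ⟨j, hj, e⟩ := h.hS s s.2 j₁ h1
  refine ⟨j, hj, ⟨_, e⟩, r, h.hRV ?_⟩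
  rw [hv, e, map_mul, map_mul, ← hrs]
  ring

lemma pb (h : DD R V K σ c z) : PB R Axy V K (S c) where
  dom := h.dom
  ded := by
    obtain ⟨_, _⟩ := h.dvr
    infer_instance
  hα := ⟨(IsScalarTower.toAlgHom R Axy K).toLinearMap, by simp⟩
  hA a := ⟨c a, h.pc a⟩
  hVK k := ⟨σ k, h.hσ k⟩
  hJ v hv := h.hmem v 0 (by rw [hv, map_zero])
  hRV := h.hRV
  loc := h.loc
  hS0 := by
    rintro ⟨a, ha, h0⟩
    refine nonZeroDivisors.ne_zero ha ?_
    rw [← h.pc a, h0, map_zero]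
  hdir j₁ j₂ h1 h2 := by
    obtain ⟨_, _⟩ := h.dvr
    rcases ValuationRing.dvd_total (algebraMap R V j₁) (algebraMap R V j₂) with hd | hd
    · exact h.hdir_aux j₁ j₂ h1 hd
    · obtain ⟨j, a, b, d⟩ := h.hdir_aux j₂ j₁ h2 hd
      exact ⟨j, a, d, b⟩
  hS := h.hS
  glA := GLD_Axy
  glV := h.glV

lemma not_V (h : DD R V K σ c z) : ¬ PDL R V 2 := by
  have := h.dom
  have hp : ∀ a : ℂ, Prime (C (X - C a) : Axy) := fun a => prime_C_iff.2 (prime_X_sub_C a)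
  refine lower_main (algebraMap R Axy) c h.pc (σ (algebraMap Axy K X)⁻¹)
    (fun a => σ (algebraMap Axy K (C (X - C a)))⁻¹) h.hRV (fun a => h.c_prime (hp a)) ?_
    (h.mul_inv X_ne_zero) (fun a => h.mul_inv (hp a).ne_zero) ?_
  · intro a b hab hd
    rw [h.hdiv (hp b).ne_zero, h.pc, C_dvd_iff_dvd_coeff] at hd
    have h1 := hd 0
    rw [coeff_C_zero, dvd_iff_isRoot] at h1
    simp [sub_eq_zero] at h1
    exact hab h1.symm
  · apply h.pb.stor_pdl
    intro q
    obtain ⟨v, rfl⟩ := Submodule.mkQ_surjective _ q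
    have := h.loc
    obtain ⟨⟨r, s⟩, hrs⟩ := IsLocalization.surj (S c) v
    refine ⟨s, s.2, ?_⟩
    rw [← map_smul]
    refine (Submodule.Quotient.mk_eq_zero _).2 ⟨(C r, 0), ?_⟩
    rw [mF_apply, Algebra.smul_def, mul_comm, hrs]
    simp

lemma not_A (h : DD R V K σ c z) : ¬ PDL R Axy 3 := by
  intro hA
  obtain ⟨_, _⟩ := h.dvr
  have hex : ∀ v : V, ∃ r, algebraMap R V r = z * v := fun v =>
    h.hmem _ 0 (by rw [map_zero]; exact (h.hz _).2 (dvd_mul_right _ _))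
  choose f hf using hex
  let F : V →ₗ[R] R :=
    { toFun := f
      map_add' := fun v w => h.hRV (by rw [map_add, hf, hf, hf, mul_add])
      map_smul' := fun r w => h.hRV (by
        rw [RingHom.id_apply, smul_eq_mul, map_mul, hf, hf, Algebra.smul_def]; ring) }
  refine h.not_V ((PDL_X3_iff F (Algebra.linearMap R Axy) ?_ ?_ h.pb.hA 1).1 hA)
  · intro v w hvw
    have h1 : algebraMap R V (f v) = algebraMap R V (f w) := congrArg _ hvw
    rw [hf, hf] at h1
    exact mul_left_cancel₀ h.hz0 h1
  · intro r
    rw [Algebra.linearMap_apply]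
    constructor
    · intro hr
      obtain ⟨v, hv⟩ := (h.hz (algebraMap R V r)).1 (by rw [comm, hr, map_zero])
      exact ⟨v, h.hRV ((hf v).trans hv.symm)⟩
    · rintro ⟨v, rfl⟩
      apply h.injA
      rw [map_zero, ← comm (V := V), h.hz]
      exact ⟨v, hf v⟩

lemma gl (h : DD R V K σ c z) : gldim R = 3 := by
  apply le_antisymm
  · refine iSup_le fun M => ?_
    exact (pd_le_iff R M 3).2 (h.pb.gld M)
  · by_contra hlt
    have h2 : gldim R ≤ (2 : ℕ) := by
      rw [not_le] at hlt
      exact Order.le_of_lt_add_one hlt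
    exact h.not_A ((pd_le_iff R (ModuleCat.of R Axy) 2).1
      ((le_iSup (fun M : ModuleCat.{0} R => pd R M) _).trans h2))

lemma wd (h : DD R V K σ c z) : wdim R = 2 := by
  have := h.dom
  apply le_antisymm
  · refine iSup_le fun M => ?_
    exact (fd_le_iff M 2).2 fun N => h.pb.TV_three M N
  · by_contra hlt
    have h2 : wdim R ≤ (1 : ℕ) := by
      rw [not_le] at hlt
      exact Order.le_of_lt_add_one hlt
    have hX : Prime (X : Axy) := prime_X
    refine not_TV_two (c (C X)) (c X) (h.c_prime hX).ne_zero ?_ ?_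
      ((fd_le_iff (ModuleCat.of R (R ⧸ Ideal.span {c (C X), c X})) 1).1
      ((le_iSup (fun M : ModuleCat.{0} R => fd R M) _).trans h2) (ModuleCat.of R _))
    · intro a ha
      rw [h.hdiv hX.ne_zero] at ha ⊢
      rw [map_mul, h.pc] at ha
      refine (hX.dvd_or_dvd ha).resolve_right fun hd => ?_
      rw [X_dvd_iff] at hd
      simp at hd
    · intro h1
      let ev : R →+* ℂ := ((evalRingHom 0).comp (evalRingHom (0 : ℂ[X]))).comp (algebraMap R Axy)
      have hle : Ideal.span {c (C X), c X} ≤ RingHom.ker ev := by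
        rw [Ideal.span_le]
        rintro r (rfl | rfl)
        · simp [ev, RingHom.mem_ker, h.pc]
        · simp [ev, RingHom.mem_ker, h.pc]
      have h3 := hle h1
      rw [RingHom.mem_ker, map_one] at h3
      exact one_ne_zero h3

lemma cot (h : DD R V K σ c z) : cotD R = 2 := by
  have := h.dom
  apply le_antisymm
  · refine iSup_le fun M => iSup_le fun hM => ?_
    exact (pd_le_iff R M 2).2 (h.pb.tf_pdl M)
  · by_contra hlt
    have h2 : cotD R ≤ (1 : ℕ) := by
      rw [not_le] at hlt
      exact Order.le_of_lt_add_one hlt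
    have := h.loc
    have hfl : Module.Flat R V := IsLocalization.flat V (S c)
    exact h.not_V ((pd_le_iff R (ModuleCat.of R V) 1).1
      ((le_iSup₂ (f := fun (M : ModuleCat.{0} R) (_ : Module.Flat R M) => pd R M)
        (ModuleCat.of R V) hfl).trans h2))
end DD

lemma of_data {R V K : Type} [CommRing R] [CommRing V] [Field K] [IsDomain R] [IsDomain V]
    [IsDiscreteValuationRing V] [Algebra Axy K] [IsFractionRing Axy K] (i : R →+* V) (ρ : V →+* K)
    (P : R →+* Axy) (σ : K →+* V) (c : Axy →+* R) (z : V)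
    (hP : ∀ r, ρ (i r) = algebraMap Axy K (P r))
    (hσ : ∀ k, ρ (σ k) = k) (hc : ∀ a, i (c a) = σ (algebraMap Axy K a))
    (hRV : Function.Injective i) (hmem : ∀ v a, ρ v = algebraMap Axy K a → ∃ r, i r = v)
    (hz : ∀ v, ρ v = 0 ↔ z ∣ v) (hz0 : z ≠ 0) (glV : GLD V 2) :
    gldim R = 3 ∧ wdim R = 2 ∧ cotD R = 2 := by
  let _ : Algebra R Axy := P.toAlgebra
  let _ : Algebra R V := i.toAlgebra
  let _ : Algebra V K := ρ.toAlgebra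
  let _ : Algebra R K := (ρ.comp i).toAlgebra
  have : IsScalarTower R V K := IsScalarTower.of_algebraMap_eq fun r => rfl
  have : IsScalarTower R Axy K := IsScalarTower.of_algebraMap_eq fun r => hP r
  have hD : DD R V K σ c z :=
    { dom := inferInstance
      dvr := ⟨inferInstance, inferInstance⟩
      frac := inferInstance
      hσ := hσ
      hc := hc
      hRV := hRV
      hmem := hmem
      hz := hz
      hz0 := hz0
      glV := glV }
  exact ⟨hD.gl, hD.wd, hD.cot⟩

/-- residue map -/
noncomputable def resV : Vc →+* Kxy :=
  IsLocalization.lift (M := (Ideal.span {X} : Ideal Kxy[X]).primeCompl) (S := Vc)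
    (g := evalRingHom (0 : Kxy)) (fun s => by
      rw [isUnit_iff_ne_zero]
      intro h
      apply s.2
      rw [SetLike.mem_coe, Ideal.mem_span_singleton, X_dvd_iff, coeff_zero_eq_eval_zero]
      exact h)

lemma resV_alg (p : Kxy[X]) : resV (algebraMap Kxy[X] Vc p) = eval 0 p :=
  IsLocalization.lift_eq _ _

lemma resV_zero (v : Vc) : resV v = 0 ↔ algebraMap Kxy[X] Vc X ∣ v := by
  constructor
  · intro hv
    obtain ⟨⟨p, s⟩, hps⟩ := IsLocalization.surj (Ideal.span {X} : Ideal Kxy[X]).primeCompl v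
    have h1 : eval 0 p = 0 := by
      rw [← resV_alg, ← hps, map_mul, hv, zero_mul]
    rw [← coeff_zero_eq_eval_zero, ← X_dvd_iff] at h1
    obtain ⟨q, rfl⟩ := h1
    have hu : IsUnit (algebraMap Kxy[X] Vc s) := IsLocalization.map_units Vc s
    rw [← hu.dvd_mul_right, hps, map_mul]
    exact dvd_mul_right _ _
  · rintro ⟨w, rfl⟩
    rw [map_mul, resV_alg, eval_X, zero_mul]

lemma ded_poly (K : Type) [Field K] : IsDedekindDomain K[X] := inferInstance

theorem final_aux (R : Subring Vc)
    (hR : ∀ x : Vc, x ∈ R ↔ ∃ a : Axy,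
      x - cxyToV a ∈ Ideal.span {algebraMap (Polynomial Kxy) Vc Polynomial.X}) :
    gldim R = 3 ∧ wdim R = 2 ∧ cotD R = 2 := by
  have hcx : ∀ a, resV (cxyToV a) = algebraMap Axy Kxy a := fun a => by
    change resV (algebraMap Kxy[X] Vc (C _)) = _
    rw [resV_alg, eval_C]
  have hR' : ∀ x : Vc, x ∈ R ↔ ∃ a : Axy, resV x = algebraMap Axy Kxy a := by
    intro x
    rw [hR]
    refine exists_congr fun a => ?_
    rw [Ideal.mem_span_singleton, ← resV_zero, map_sub, hcx, sub_eq_zero]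
  have hinj : Function.Injective (algebraMap Axy Kxy) := IsFractionRing.injective Axy Kxy
  have hex : ∀ r : R, ∃ a : Axy, resV r.1 = algebraMap Axy Kxy a := fun r => (hR' _).1 r.2
  choose π hπ using hex
  let P : R →+* Axy :=
    { toFun := π
      map_one' := hinj (by rw [← hπ]; simp)
      map_mul' := fun r s => hinj (by rw [← hπ, map_mul, ← hπ, ← hπ]; simp)
      map_zero' := hinj (by rw [← hπ]; simp)
      map_add' := fun r s => hinj (by rw [← hπ, map_add, ← hπ, ← hπ]; simp) }
  let c : Axy →+* R := cxyToV.codRestrict R fun a => (hR' _).2 ⟨a, hcx a⟩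
  have : IsDedekindDomain Kxy[X] := ded_poly Kxy
  have : IsDiscreteValuationRing Vc :=
    IsLocalization.AtPrime.isDiscreteValuationRing_of_dedekind_domain
        Kxy[X] (P := Ideal.span {X}) (by
          rw [Ne, Ideal.span_singleton_eq_bot]; exact X_ne_zero) Vc
  refine of_data R.subtype resV P ((algebraMap Kxy[X] Vc).comp C) c (algebraMap Kxy[X] Vc X)
    hπ ?_ (fun a => rfl) Subtype.val_injective
    (fun v a hv => ⟨⟨v, (hR' v).2 ⟨a, hv⟩⟩, rfl⟩) resV_zero ?_ GLD_Vc
  · intro k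
    change resV (algebraMap Kxy[X] Vc (C k)) = k
    rw [resV_alg, eval_C]
  · rw [Ne, FaithfulSMul.algebraMap_eq_zero_iff]
    exact X_ne_zero
end PFinal

/-- For `V = ℂ(X,Y)[Z]_{(Z)} = ℂ(X,Y) + ZV` and `R = ℂ[X,Y] + ZV` one has
`gldim R = 3`, `wdim R = 2` and `cot.D R = 2`; in particular
`cot.D R < gldim R < cot.D R + wdim R`. -/
theorem stmt_19 (R : Subring Vc)
    (hR : ∀ x : Vc, x ∈ R ↔ ∃ a : Axy,
      x - cxyToV a ∈ Ideal.span {algebraMap (Polynomial Kxy) Vc Polynomial.X}) :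
    gldim R = 3 ∧ wdim R = 2 ∧ cotD R = 2 ∧
      cotD R < gldim R ∧ gldim R < cotD R + wdim R := by
  obtain ⟨h1, h2, h3⟩ := final_aux R hR
  refine ⟨h1, h2, h3, ?_, ?_⟩
  · rw [h1, h3]; norm_num
  · rw [h1, h2, h3]; norm_num
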